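/- arXiv:2206.04660 — 2 statements merged into one kernel-verified Lean document; each statement's English description precedes it below -/
import Mathlib

section
/- There exist γ ∈ ℳ̃ and ν ∈ ℳ ∖ ℳ̃ such that 𝒪(ν) = γ, D(ν|μ₁) < ∞, and D(γ|μ₁) = ∞. -/
open MeasureTheory Filter Topology
open scoped ENNReal

noncomputable section

/-- The plane `ℝ²`, carrier for measures on the unit square. -/
abbrev Ω2 : Type := ℝ × ℝ

/-- The unit square `[0,1]² ⊆ ℝ²`. -/
def unitSq : Set Ω2 := Set.Icc (0 : ℝ) 1 ×ˢ Set.Icc (0 : ℝ) 1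

/-- Lebesgue measure on the unit square. -/
def lebSq : Measure Ω2 := volume.restrict unitSq

/-- `𝒫`: Borel probability measures concentrated on the unit square. -/
def Pcal : Set (ProbabilityMeasure Ω2) := {μ | (μ : Measure Ω2) unitSq = 1}

/-- `ℳ`: members of `𝒫` whose two coordinate marginals are atomless
(equivalently, have continuous CDFs). -/
def Mcal : Set (ProbabilityMeasure Ω2) :=
  {μ | μ ∈ Pcal ∧ (∀ x : ℝ, (μ : Measure Ω2).map Prod.fst {x} = 0) ∧
      ∀ y : ℝ, (μ : Measure Ω2).map Prod.snd {y} = 0}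

/-- The uniform distribution on `[0,1]`. -/
def unif01 : Measure ℝ := volume.restrict (Set.Icc (0 : ℝ) 1)

/-- `ℳ̃`: permutons, i.e. members of `𝒫` with both marginals uniform on `[0,1]`. -/
def Mtilde : Set (ProbabilityMeasure Ω2) :=
  {μ | μ ∈ Pcal ∧ (μ : Measure Ω2).map Prod.fst = unif01 ∧
      (μ : Measure Ω2).map Prod.snd = unif01}

open scoped Classical in
/-- `h_σ`: indicator that the `k` points induce the pattern `σ`. -/
def hPat {k : ℕ} (σ : Equiv.Perm (Fin k)) (z : Fin k → Ω2) : ℝ :=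
  if ∃ τ : Equiv.Perm (Fin k),
      StrictMono (fun i => (z (τ i)).1) ∧ StrictMono (fun i => (z (τ (σ⁻¹ i))).2)
  then 1 else 0

/-- Pattern density `t_σ(ν) = ∫ h_σ dν^{⊗k}`. -/
def tPat {k : ℕ} (σ : Equiv.Perm (Fin k)) (ν : Measure Ω2) : ℝ :=
  ∫ z, hPat σ z ∂(Measure.pi fun _ : Fin k => ν)

open scoped Classical in
/-- The permutation induced by `n` labelled points of `ℝ²` (junk value `1` if the
coordinates are not in generic position). -/
def inducedPerm {n : ℕ} (z : Fin n → Ω2) : Equiv.Perm (Fin n) :=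
  if h : ∃ σ : Equiv.Perm (Fin n), hPat σ z = 1 then h.choose else 1

/-- Empirical measure `Em(π) = (1/n) ∑ δ_{(i/n, π(i)/n)}` of a permutation, as a measure. -/
def EmM {n : ℕ} (π : Equiv.Perm (Fin n)) : Measure Ω2 :=
  (n : ℝ≥0∞)⁻¹ • ∑ i : Fin n, Measure.dirac ((((i : ℕ) + 1 : ℝ)) / n, (((π i : ℕ) + 1 : ℝ)) / n)

open scoped Classical in
/-- Empirical measure of a permutation as a probability measure (junk value for `n = 0`). -/
def EmP {n : ℕ} (π : Equiv.Perm (Fin n)) : ProbabilityMeasure Ω2 :=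
  if h : IsProbabilityMeasure (EmM π) then ⟨EmM π, h⟩
  else ⟨Measure.dirac 0, by infer_instance⟩

/-- `t_σ(π) := t_σ(Em(π))`. -/
def tPerm {k n : ℕ} (σ : Equiv.Perm (Fin k)) (π : Equiv.Perm (Fin n)) : ℝ := tPat σ (EmM π)

open scoped Classical in
/-- Kullback–Leibler divergence `D(ν|μ) ∈ [0,∞]`; for probability measures with `ν ≪ μ`
it equals `∫ log(dν/dμ) dν`, written here through the nonnegative integrand
`g log g + 1 - g` of the density `g = dν/dμ` (the correction `∫ (1-g) dμ = 0`). -/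
def KL (ν μ : Measure Ω2) : ℝ≥0∞ :=
  if ν ≪ μ then
    ∫⁻ z, ENNReal.ofReal ((ν.rnDeriv μ z).toReal * Real.log ((ν.rnDeriv μ z).toReal)
      + 1 - (ν.rnDeriv μ z).toReal) ∂μ
  else ∞

/-- CDF of the first marginal. -/
def cdfX (μ : Measure Ω2) (x : ℝ) : ℝ := (μ {p : Ω2 | p.1 ≤ x}).toReal

/-- CDF of the second marginal. -/
def cdfY (μ : Measure Ω2) (y : ℝ) : ℝ := (μ {p : Ω2 | p.2 ≤ y}).toReal

/-- The map `𝒪`: pushforward of `μ` under `(x,y) ↦ (F₁(x), F₂(y))`. -/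
def Omap (μ : Measure Ω2) : Measure Ω2 := μ.map fun p => (cdfX μ p.1, cdfY μ p.2)

/-- The product measure `μ^{⊗n}` governing `n` i.i.d. samples. -/
def pmeas (μ : Measure Ω2) (n : ℕ) : Measure (Fin n → Ω2) := Measure.pi fun _ => μ

/-- Log-partition function `F_n(σ,μ,θ) = log E[exp(nθ t_σ(π_{n,μ}))]`. -/
def Fn {k : ℕ} (σ : Equiv.Perm (Fin k)) (μ : Measure Ω2) (θ : ℝ) (n : ℕ) : ℝ :=
  Real.log (∫ z, Real.exp (n * θ * tPerm σ (inducedPerm z)) ∂pmeas μ n)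

/-- The Gibbs measure `Q_{n,σ,μ,θ}` on `([0,1]²)ⁿ`. -/
def Qgibbs {k : ℕ} (σ : Equiv.Perm (Fin k)) (μ : Measure Ω2) (θ : ℝ) (n : ℕ) :
    Measure (Fin n → Ω2) :=
  (pmeas μ n).withDensity fun z =>
    ENNReal.ofReal (Real.exp (n * θ * tPerm σ (inducedPerm z) - Fn σ μ θ n))

/-- `F(σ,μ,θ) = sup_{ν ∈ ℳ} { θ t_σ(ν) − D(ν|μ) }`, valued in `EReal`. -/
def Fsup {k : ℕ} (σ : Equiv.Perm (Fin k)) (μ : Measure Ω2) (θ : ℝ) : EReal :=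
  ⨆ ν ∈ Mcal, (((θ * tPat σ (ν : Measure Ω2) : ℝ) : EReal) - ((KL (↑ν) μ : ℝ≥0∞) : EReal))

/-- `ℱ(σ,μ,θ)`: the set of maximizers of `ν ↦ θ t_σ(ν) − D(ν|μ)` over `ℳ`. -/
def Fset {k : ℕ} (σ : Equiv.Perm (Fin k)) (μ : Measure Ω2) (θ : ℝ) :
    Set (ProbabilityMeasure Ω2) :=
  {ν | ν ∈ Mcal ∧
    (((θ * tPat σ (ν : Measure Ω2) : ℝ) : EReal) - ((KL (↑ν) μ : ℝ≥0∞) : EReal)) = Fsup σ μ θ}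

/-- `G(σ,μ,δ) = inf { D(ν|μ) : ν ∈ ℳ, t_σ(ν) ≥ δ }`. -/
def Gfun {k : ℕ} (σ : Equiv.Perm (Fin k)) (μ : Measure Ω2) (δ : ℝ) : ℝ≥0∞ :=
  ⨅ ν ∈ {ν : ProbabilityMeasure Ω2 | ν ∈ Mcal ∧ δ ≤ tPat σ (ν : Measure Ω2)}, KL (↑ν) μ

/-- `𝒢(σ,μ,δ)`: the set of minimizers in the definition of `G(σ,μ,δ)`. -/
def Gset {k : ℕ} (σ : Equiv.Perm (Fin k)) (μ : Measure Ω2) (δ : ℝ) :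
    Set (ProbabilityMeasure Ω2) :=
  {ν | (ν ∈ Mcal ∧ δ ≤ tPat σ (ν : Measure Ω2)) ∧ KL (↑ν) μ = Gfun σ μ δ}

/-- `α_σ(μ) = inf {δ : G(σ,μ,δ) = ∞}`. -/
def alphaSig {k : ℕ} (σ : Equiv.Perm (Fin k)) (μ : Measure Ω2) : ℝ :=
  sInf {δ : ℝ | Gfun σ μ δ = ∞}

/-- `μ` is conditionally constant (CC) with respect to a pattern `σ` of size `k+1`:
the conditional probability `P(π_{X,Y} = σ | (X₁,Y₁))`, which for i.i.d. samples equals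
`z ↦ ∫ h_σ(z, w) dμ^{⊗k}(w)`, is `μ`-a.s. equal to a constant `c ∈ [0,1]`. -/
def IsCC {k : ℕ} (σ : Equiv.Perm (Fin (k + 1))) (μ : Measure Ω2) : Prop :=
  ∃ c ∈ Set.Icc (0 : ℝ) 1, ∀ᵐ z ∂μ,
    (∫ w : Fin k → Ω2, hPat σ (Fin.cons z w) ∂pmeas μ k) = c

/-- The inversion pattern `21 ∈ S₂`. -/
def inv2 : Equiv.Perm (Fin 2) := Equiv.swap 0 1

/-- Lévy–Prokhorov (extended) distance between measures on `ℝ²`. -/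
def dLPE (μ ν : Measure Ω2) : ℝ≥0∞ := levyProkhorovEDist μ ν

/-- The topological support of a measure: the points whose every open neighbourhood
has positive measure. -/
def msupport (μ : Measure Ω2) : Set Ω2 :=
  {z | ∀ U : Set Ω2, IsOpen U → z ∈ U → 0 < μ U}


/-- The permuton `μ₁`: `X ~ Unif[0,1]`; given `X`, `Y ~ Unif[0,1/2]` if `X < 1/2` and
`Y ~ Unif[1/2,1]` if `X > 1/2`; its density is `2` on `[0,1/2]² ∪ [1/2,1]²`. -/
def mu1M : Measure Ω2 :=
  (2 : ℝ≥0∞) • volume.restrict (Set.Icc (0 : ℝ) (1/2) ×ˢ Set.Icc (0 : ℝ) (1/2)) +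
  (2 : ℝ≥0∞) • volume.restrict (Set.Icc (1/2 : ℝ) 1 ×ˢ Set.Icc (1/2 : ℝ) 1)

/-- The uniform distribution on `[0,1/2]`. -/
def unifHalf : Measure ℝ := (2 : ℝ≥0∞) • volume.restrict (Set.Icc (0 : ℝ) (1/2))

instance : IsProbabilityMeasure unif01 := ⟨by simp [unif01]⟩

instance : IsProbabilityMeasure unifHalf := ⟨by
  simp only [unifHalf, Measure.smul_apply, Measure.restrict_apply_univ, Real.volume_Icc,
    smul_eq_mul]
  rw [← ENNReal.ofReal_ofNat, ← ENNReal.ofReal_mul (by norm_num)]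
  norm_num⟩

lemma unifHalf_Iic {x : ℝ} (hx : x ∈ Set.Icc (0 : ℝ) (1/2)) :
    (unifHalf (Set.Iic x)).toReal = 2 * x := by
  have h : Set.Iic x ∩ Set.Icc (0 : ℝ) (1/2) = Set.Icc 0 x := by
    ext y
    simp only [Set.mem_inter_iff, Set.mem_Iic, Set.mem_Icc] at *
    constructor
    · tauto
    · rintro ⟨h₁, h₂⟩
      exact ⟨h₂, h₁, h₂.trans hx.2⟩
  rw [unifHalf, Measure.smul_apply, Measure.restrict_apply measurableSet_Iic, h]
  simp [hx.1]

lemma map_two_mul_unifHalf : unifHalf.map (fun x => 2 * x) = unif01 := by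
  have hm : Measurable (fun x : ℝ => 2 * x) := by fun_prop
  have hpre : Set.Icc (0 : ℝ) (1/2) = (fun x : ℝ => 2 * x) ⁻¹' Set.Icc (0 : ℝ) 1 := by
    ext x
    simp only [Set.mem_Icc, Set.mem_preimage]
    constructor <;> rintro ⟨h₁, h₂⟩ <;> constructor <;> linarith
  have hv : (2 : ℝ≥0∞) • volume.map (fun x : ℝ => 2 * x) = volume := by
    simpa using Real.smul_map_volume_mul_left (a := 2) two_ne_zero
  rw [unifHalf, unif01, Measure.map_smul, hpre, ← Measure.restrict_map hm measurableSet_Icc,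
    ← Measure.restrict_smul, hv]

lemma cdfX_prod (μ ν : Measure ℝ) [SFinite μ] [IsProbabilityMeasure ν] (x : ℝ) :
    cdfX (μ.prod ν) x = (μ (Set.Iic x)).toReal := by
  have h : {p : Ω2 | p.1 ≤ x} = Set.Iic x ×ˢ Set.univ := by ext; simp
  simp [cdfX, h, Measure.prod_prod]

lemma cdfY_prod (μ ν : Measure ℝ) [IsProbabilityMeasure μ] [SFinite ν] (y : ℝ) :
    cdfY (μ.prod ν) y = (ν (Set.Iic y)).toReal := by
  have h : {p : Ω2 | p.2 ≤ y} = Set.univ ×ˢ Set.Iic y := by ext; simp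
  simp [cdfY, h, Measure.prod_prod]

lemma ae_unifHalf_mem : ∀ᵐ x ∂unifHalf, x ∈ Set.Icc (0 : ℝ) (1/2) :=
  Measure.ae_smul_measure (ae_restrict_mem measurableSet_Icc) _

lemma Omap_unifHalf_prod : Omap (unifHalf.prod unifHalf) = unif01.prod unif01 := by
  have h : (fun p : Ω2 => (cdfX (unifHalf.prod unifHalf) p.1, cdfY (unifHalf.prod unifHalf) p.2))
      =ᵐ[unifHalf.prod unifHalf] Prod.map (fun x => 2 * x) (fun x => 2 * x) := by
    filter_upwards [Measure.quasiMeasurePreserving_fst.ae ae_unifHalf_mem,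
      Measure.quasiMeasurePreserving_snd.ae ae_unifHalf_mem] with p h₁ h₂
    rw [cdfX_prod, cdfY_prod, unifHalf_Iic h₁, unifHalf_Iic h₂, Prod.map]
  rw [Omap, Measure.map_congr h, ← Measure.map_prod_map _ _ (by fun_prop) (by fun_prop),
    map_two_mul_unifHalf]

lemma unifHalf_prod_le : unifHalf.prod unifHalf ≤ (2 : ℝ≥0∞) • mu1M := by
  rw [unifHalf, Measure.prod_smul_left, Measure.prod_smul_right, Measure.prod_restrict,
    ← Measure.volume_eq_prod, mu1M]
  gcongr
  exact Measure.le_add_right le_rfl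

instance : IsFiniteMeasure mu1M := by
  have (a b c d : ℝ) : IsFiniteMeasure
      ((volume : Measure Ω2).restrict (Set.Icc a b ×ˢ Set.Icc c d)) :=
    isFiniteMeasure_restrict.2 (isCompact_Icc.prod isCompact_Icc).measure_lt_top.ne
  have (ρ : Measure Ω2) [IsFiniteMeasure ρ] : IsFiniteMeasure ((2 : ℝ≥0∞) • ρ) :=
    ρ.smul_finite ENNReal.ofNat_ne_top
  unfold mu1M
  infer_instance

/-- A measure dominated by `2μ` has finite divergence from the finite measure `μ`. -/
lemma KL_lt_top_of_le_two_smul {ν μ : Measure Ω2} [IsFiniteMeasure ν] [IsFiniteMeasure μ]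
    (h : ν ≤ (2 : ℝ≥0∞) • μ) : KL ν μ < ∞ := by
  have hac : ν ≪ μ := (Measure.absolutelyContinuous_of_le h).trans
    Measure.smul_absolutelyContinuous
  have hle : ν.rnDeriv μ ≤ᵐ[μ] fun _ => 2 := by
    refine ae_le_of_forall_setLIntegral_le_of_sigmaFinite (Measure.measurable_rnDeriv ν μ)
      fun s _ _ => ?_
    rw [Measure.setLIntegral_rnDeriv hac, setLIntegral_const]
    simpa using h s
  rw [KL, if_pos hac]
  refine lt_of_le_of_lt (lintegral_mono_ae (g := fun _ => 1) ?_) (by simp)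
  filter_upwards [hle] with z hz
  set r := (ν.rnDeriv μ z).toReal with hr
  have h₀ : 0 ≤ r := ENNReal.toReal_nonneg
  have h₂ : r ≤ 2 := ENNReal.toReal_le_of_le_ofReal (by norm_num) (by simpa using hz)
  rw [ENNReal.ofReal_le_one]
  rcases h₀.eq_or_lt with h₀ | h₀
  · simp [← h₀]
  · nlinarith [mul_le_mul_of_nonneg_left (Real.log_le_sub_one_of_pos h₀) h₀.le]

lemma not_unif01_prod_absolutelyContinuous : ¬ unif01.prod unif01 ≪ mu1M := by
  intro hac
  have h : mu1M (Set.Ioo (0 : ℝ) (1/2) ×ˢ Set.Ioo (1/2 : ℝ) 1) = 0 := by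
    have hm : MeasurableSet (Set.Ioo (0 : ℝ) (1/2) ×ˢ Set.Ioo (1/2 : ℝ) 1) :=
      measurableSet_Ioo.prod measurableSet_Ioo
    have h₁ : Set.Ioo (0 : ℝ) (1/2) ×ˢ Set.Ioo (1/2 : ℝ) 1 ∩
        Set.Icc (0 : ℝ) (1/2) ×ˢ Set.Icc (0 : ℝ) (1/2) = ∅ := by
      ext p
      simp only [Set.mem_inter_iff, Set.mem_prod, Set.mem_Ioo, Set.mem_Icc,
        Set.mem_empty_iff_false, iff_false]
      rintro ⟨⟨_, h⟩, _, h'⟩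
      exact h.1.not_ge h'.2
    have h₂ : Set.Ioo (0 : ℝ) (1/2) ×ˢ Set.Ioo (1/2 : ℝ) 1 ∩
        Set.Icc (1/2 : ℝ) 1 ×ˢ Set.Icc (1/2 : ℝ) 1 = ∅ := by
      ext p
      simp only [Set.mem_inter_iff, Set.mem_prod, Set.mem_Ioo, Set.mem_Icc,
        Set.mem_empty_iff_false, iff_false]
      rintro ⟨⟨h, _⟩, h', _⟩
      exact h.2.not_ge h'.1
    rw [mu1M, Measure.add_apply, Measure.smul_apply, Measure.smul_apply,
      Measure.restrict_apply hm, Measure.restrict_apply hm, h₁, h₂]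
    simp
  have hsub₁ : Set.Ioo (0 : ℝ) (1/2) ⊆ Set.Icc 0 1 :=
    Set.Ioo_subset_Icc_self.trans (Set.Icc_subset_Icc le_rfl (by norm_num))
  have hsub₂ : Set.Ioo (1/2 : ℝ) 1 ⊆ Set.Icc 0 1 :=
    Set.Ioo_subset_Icc_self.trans (Set.Icc_subset_Icc (by norm_num) le_rfl)
  have h' := hac h
  rw [Measure.prod_prod, unif01, Measure.restrict_apply measurableSet_Ioo,
    Measure.restrict_apply measurableSet_Ioo, Set.inter_eq_left.2 hsub₁,
    Set.inter_eq_left.2 hsub₂, Real.volume_Ioo, Real.volume_Ioo, mul_eq_zero,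
    ENNReal.ofReal_eq_zero, ENNReal.ofReal_eq_zero] at h'
  norm_num at h'

lemma map_fst_prod_self (μ : Measure ℝ) [IsProbabilityMeasure μ] :
    (μ.prod μ).map Prod.fst = μ := by
  simp [Measure.map_fst_prod]

lemma map_snd_prod_self (μ : Measure ℝ) [IsProbabilityMeasure μ] :
    (μ.prod μ).map Prod.snd = μ := by
  simp [Measure.map_snd_prod]

lemma unif01_Icc : unif01 (Set.Icc 0 1) = 1 := by simp [unif01]

lemma unifHalf_Icc : unifHalf (Set.Icc 0 1) = 1 := by
  rw [← prob_compl_eq_zero_iff measurableSet_Icc]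
  refine measure_mono_null ?_ ae_unifHalf_mem
  intro x hx hx'
  exact hx ⟨hx'.1, hx'.2.trans (by norm_num)⟩

lemma unifHalf_singleton (x : ℝ) : unifHalf {x} = 0 := by simp [unifHalf]

lemma unifHalf_ne_unif01 : unifHalf ≠ unif01 := by
  intro h
  have h₁ : (unifHalf (Set.Iic (1/2))).toReal = 1 := by
    rw [unifHalf_Iic (by norm_num)]
    norm_num
  have h₂ : Set.Iic (1/2 : ℝ) ∩ Set.Icc 0 1 = Set.Icc 0 (1/2) := by
    ext y
    simp only [Set.mem_inter_iff, Set.mem_Iic, Set.mem_Icc]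
    constructor
    · tauto
    · rintro ⟨h₁, h₂⟩
      exact ⟨h₂, h₁, h₂.trans (by norm_num)⟩
  rw [h, unif01, Measure.restrict_apply measurableSet_Iic, h₂, Real.volume_Icc,
    ENNReal.toReal_ofReal (by norm_num)] at h₁
  norm_num at h₁

/-- Proposition 1.7: there are `γ ∈ ℳ̃` and `ν ∈ ℳ ∖ ℳ̃` with
`𝒪(ν) = γ`, `D(ν|μ₁) < ∞` but `D(γ|μ₁) = ∞`. -/
theorem rate_needs_Mcal :
    ∃ γ ν : ProbabilityMeasure Ω2,
      γ ∈ Mtilde ∧ ν ∈ Mcal ∧ ν ∉ Mtilde ∧ Omap (↑ν) = (γ : Measure Ω2) ∧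
      KL (↑ν) mu1M < ∞ ∧ KL (↑γ) mu1M = ∞ := by
  refine ⟨⟨unif01.prod unif01, inferInstance⟩, ⟨unifHalf.prod unifHalf, inferInstance⟩,
    ⟨?_, map_fst_prod_self _, map_snd_prod_self _⟩, ⟨?_, fun x => ?_, fun y => ?_⟩, fun h => ?_,
    Omap_unifHalf_prod,
    KL_lt_top_of_le_two_smul (ν := unifHalf.prod unifHalf) unifHalf_prod_le,
    if_neg not_unif01_prod_absolutelyContinuous⟩
  · change (unif01.prod unif01) unitSq = 1
    rw [unitSq, Measure.prod_prod, unif01_Icc, one_mul]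
  · change (unifHalf.prod unifHalf) unitSq = 1
    rw [unitSq, Measure.prod_prod, unifHalf_Icc, one_mul]
  · change (unifHalf.prod unifHalf).map Prod.fst {x} = 0
    rw [map_fst_prod_self, unifHalf_singleton]
  · change (unifHalf.prod unifHalf).map Prod.snd {y} = 0
    rw [map_snd_prod_self, unifHalf_singleton]
  · exact unifHalf_ne_unif01 ((map_fst_prod_self _).symm.trans h.2.1)

end
end

section
/- For every pattern σ ∈ S_k, every μ ∈ ℳ and every θ ∈ ℝ, F_n(σ,μ,θ)/n → F(σ,μ,θ) := sup_{ν∈ℳ} { θ t_σ(ν) − D(ν|μ) } as n → ∞. -/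
open MeasureTheory Filter Topology
open scoped ENNReal

noncomputable section

lemma hPat_nonneg {k : ℕ} (σ : Equiv.Perm (Fin k)) (z : Fin k → Ω2) : 0 ≤ hPat σ z := by
  unfold hPat; split_ifs <;> norm_num

lemma hPat_le_one {k : ℕ} (σ : Equiv.Perm (Fin k)) (z : Fin k → Ω2) : hPat σ z ≤ 1 := by
  unfold hPat; split_ifs <;> norm_num

lemma hPat_congr {k : ℕ} (σ : Equiv.Perm (Fin k)) {z w : Fin k → Ω2}
    (h₁ : ∀ i j, (z i).1 < (z j).1 ↔ (w i).1 < (w j).1)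
    (h₂ : ∀ i j, (z i).2 < (z j).2 ↔ (w i).2 < (w j).2) : hPat σ z = hPat σ w := by
  have h : (∃ τ : Equiv.Perm (Fin k),
      StrictMono (fun i => (z (τ i)).1) ∧ StrictMono (fun i => (z (τ (σ⁻¹ i))).2)) ↔
      ∃ τ : Equiv.Perm (Fin k),
        StrictMono (fun i => (w (τ i)).1) ∧ StrictMono (fun i => (w (τ (σ⁻¹ i))).2) := by
    simp only [StrictMono, h₁, h₂]
  exact if_congr h rfl rfl

lemma hPat_eq_zero_of_not_injective {k : ℕ} (σ : Equiv.Perm (Fin k)) {z : Fin k → Ω2}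
    (hz : ¬ Function.Injective z) : hPat σ z = 0 := by
  refine if_neg ?_
  rintro ⟨τ, h₁, -⟩
  refine hz fun i j hij => ?_
  have := h₁.injective (a₁ := τ.symm i) (a₂ := τ.symm j) (by simp [hij])
  simpa using this

lemma measurable_hPat {k : ℕ} (σ : Equiv.Perm (Fin k)) : Measurable (hPat σ) := by
  refine Measurable.ite ?_ measurable_const measurable_const
  simp only [StrictMono, Set.ofPred_exists, Set.ofPred_and, Set.ofPred_forall]
  refine MeasurableSet.iUnion fun τ => MeasurableSet.inter ?_ ?_ <;>
  · refine MeasurableSet.iInter fun i => MeasurableSet.iInter fun j =>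
      MeasurableSet.iInter fun _ => ?_
    exact measurableSet_lt (by fun_prop) (by fun_prop)

lemma integrable_hPat {k : ℕ} (σ : Equiv.Perm (Fin k)) {α : Type*} [MeasurableSpace α]
    (ρ : Measure α) [IsFiniteMeasure ρ] {f : α → Fin k → Ω2} (hf : Measurable f) :
    Integrable (fun a => hPat σ (f a)) ρ := by
  refine Integrable.of_bound ((measurable_hPat σ).comp hf).aestronglyMeasurable 1
    (Eventually.of_forall fun a => ?_)
  rw [Real.norm_of_nonneg (hPat_nonneg _ _)]
  exact hPat_le_one _ _

lemma tPat_nonneg {k : ℕ} (σ : Equiv.Perm (Fin k)) (ν : Measure Ω2) : 0 ≤ tPat σ ν :=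
  integral_nonneg fun z => hPat_nonneg σ z

lemma tPat_le_one {k : ℕ} (σ : Equiv.Perm (Fin k)) (ν : Measure Ω2) [IsProbabilityMeasure ν] :
    tPat σ ν ≤ 1 := by
  refine (integral_mono (integrable_hPat σ _ measurable_id) (integrable_const (1 : ℝ))
    fun z => hPat_le_one σ z).trans ?_
  simp

open ProbabilityTheory in
/-- Restricting a power of a probability measure to an injective choice of coordinates. -/
lemma pi_map_comp_injective {α ι κ : Type*} [MeasurableSpace α] [Fintype ι] [Fintype κ]
    (ν : Measure α) [IsProbabilityMeasure ν] {f : ι → κ} (hf : Function.Injective f) :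
    (Measure.pi fun _ : κ => ν).map (fun z i => z (f i)) = Measure.pi fun _ : ι => ν := by
  have h := (iIndepFun_pi (μ := fun _ : κ => ν) (X := fun _ => id)
    (fun _ => aemeasurable_id)).precomp hf
  have h' : iIndepFun (fun i (z : κ → α) => z (f i)) (Measure.pi fun _ : κ => ν) := h
  rw [(iIndepFun_iff_map_fun_eq_pi_map
    (fun i => (measurable_pi_apply (f i)).aemeasurable)).1 h']
  congr 1
  funext i
  exact (measurePreserving_eval (fun _ : κ => ν) (f i)).map_eq

lemma measureReal_tie_le {α ι : Type*} [MeasurableSpace α] [Fintype ι] {M : ℕ}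
    (ν : Measure α) [IsProbabilityMeasure ν] {a : α → Fin M} (ha : Measurable a) {δ : ℝ}
    (hδ : ∀ v, ν.real (a ⁻¹' {v}) ≤ δ) {i j : ι} (hij : i ≠ j) :
    (Measure.pi fun _ : ι => ν).real {z | a (z i) = a (z j)} ≤ δ := by
  have hf : Function.Injective ![i, j] := by
    intro p q; fin_cases p <;> fin_cases q <;> simp [hij, hij.symm]
  have hpm := pi_map_comp_injective ν hf
  have hset : {z : ι → α | a (z i) = a (z j)} = ⋃ v : Fin M,
      (fun (z : ι → α) p => z (![i, j] p)) ⁻¹' (Set.univ.pi fun _ => a ⁻¹' {v}) := by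
    ext z
    simp [Fin.forall_fin_two, Set.mem_pi]
    exact eq_comm
  have hms : ∀ v, MeasurableSet (Set.univ.pi fun _ : Fin 2 => a ⁻¹' {v}) := fun v =>
    MeasurableSet.univ_pi fun _ => ha (measurableSet_singleton v)
  have hmf : Measurable fun (z : ι → α) p => z (![i, j] p) := by fun_prop
  have hsum : ∑ v, ν.real (a ⁻¹' {v}) = 1 := by
    rw [← measureReal_biUnion_finset (fun u _ v _ huv => ?_)
      (fun v _ => ha (measurableSet_singleton v))]
    · have : (⋃ b ∈ (Finset.univ : Finset (Fin M)), a ⁻¹' {b}) = Set.univ := by ext x; simp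
      rw [this]; simp
    · exact Disjoint.preimage _ (by simpa using huv)
  calc _ ≤ ∑ v, (Measure.pi fun _ : ι => ν).real ((fun (z : ι → α) p => z (![i, j] p)) ⁻¹'
        (Set.univ.pi fun _ => a ⁻¹' {v})) := by
        rw [hset]; exact measureReal_iUnion_fintype_le _
    _ = ∑ v, ν.real (a ⁻¹' {v}) * ν.real (a ⁻¹' {v}) := by
        refine Finset.sum_congr rfl fun v _ => ?_
        rw [← map_measureReal_apply hmf (hms v), hpm]
        simp [measureReal_def, Measure.pi_pi, sq]
    _ ≤ ∑ v, δ * ν.real (a ⁻¹' {v}) :=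
        Finset.sum_le_sum fun v _ => mul_le_mul_of_nonneg_right (hδ v) measureReal_nonneg
    _ = δ := by rw [← Finset.mul_sum, hsum, mul_one]

/-- The real coordinates of a cell of a finite grid. -/
def gridPoint {M N : ℕ} (v : Fin M × Fin N) : Ω2 := ((v.1 : ℕ), (v.2 : ℕ))

lemma abs_hPat_sub_hPat_grid_le {k M N : ℕ} (σ : Equiv.Perm (Fin k)) {a : ℝ → Fin M}
    {b : ℝ → Fin N} (ha : Monotone a) (hb : Monotone b) (z : Fin k → Ω2) :
    |hPat σ z - hPat σ (fun i => gridPoint (a (z i).1, b (z i).2))| ≤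
      ∑ p ∈ (Finset.univ : Finset (Fin k)).offDiag,
        ({z : Fin k → Ω2 | a (z p.1).1 = a (z p.2).1}.indicator 1 z +
          {z : Fin k → Ω2 | b (z p.1).2 = b (z p.2).2}.indicator 1 z : ℝ) := by
  have hnn : ∀ p : Fin k × Fin k, (0 : ℝ) ≤
      {z : Fin k → Ω2 | a (z p.1).1 = a (z p.2).1}.indicator 1 z ∧ (0 : ℝ) ≤
          {z : Fin k → Ω2 | b (z p.1).2 = b (z p.2).2}.indicator 1 z := fun p =>
    ⟨Set.indicator_nonneg (fun _ _ => zero_le_one) _,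
      Set.indicator_nonneg (fun _ _ => zero_le_one) _⟩
  have hcmp : ∀ {K : ℕ} {c : ℝ → Fin K} (_ : Monotone c) {x : Fin k → ℝ}
      (_ : ∀ i j, i ≠ j → c (x i) ≠ c (x j)) (i j : Fin k),
      x i < x j ↔ ((c (x i) : ℕ) : ℝ) < ((c (x j) : ℕ) : ℝ) := by
    intro K c hc x hx i j
    rw [Nat.cast_lt, Fin.val_fin_lt]
    refine ⟨fun h => (hc h.le).lt_of_ne (hx i j ?_), fun h => hc.reflect_lt h⟩
    rintro rfl
    exact lt_irrefl _ h
  by_cases htie : ∃ p : Fin k × Fin k, p.1 ≠ p.2 ∧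
      (a (z p.1).1 = a (z p.2).1 ∨ b (z p.1).2 = b (z p.2).2)
  · obtain ⟨p, hp, hor⟩ := htie
    have h1 : |hPat σ z - hPat σ (fun i => gridPoint (a (z i).1, b (z i).2))| ≤ 1 := by
      rw [abs_le]
      constructor <;>
      linarith [hPat_nonneg σ z, hPat_le_one σ z,
        hPat_nonneg σ (fun i => gridPoint (a (z i).1, b (z i).2)),
        hPat_le_one σ (fun i => gridPoint (a (z i).1, b (z i).2))]
    refine h1.trans (le_trans ?_ (Finset.single_le_sum
      (fun q _ => add_nonneg (hnn q).1 (hnn q).2) (by simpa using hp : p ∈ _)))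
    have := hnn p
    rcases hor with h | h
    · rw [Set.indicator_of_mem (show z ∈ {z : Fin k → Ω2 | a (z p.1).1 = a (z p.2).1} from h)]
      simpa using this.2
    · rw [add_comm, Set.indicator_of_mem
        (show z ∈ {z : Fin k → Ω2 | b (z p.1).2 = b (z p.2).2} from h)]
      simpa using this.1
  · push Not at htie
    rw [hPat_congr σ (w := fun i => gridPoint (a (z i).1, b (z i).2))
      (hcmp ha fun i j h => (htie (i, j) h).1) (hcmp hb fun i j h => (htie (i, j) h).2),
      sub_self, abs_zero]
    exact Finset.sum_nonneg fun q _ => add_nonneg (hnn q).1 (hnn q).2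

lemma abs_tPat_sub_integral_grid_le {k M N : ℕ} (σ : Equiv.Perm (Fin k)) {a : ℝ → Fin M}
    {b : ℝ → Fin N} (ha : Monotone a) (hb : Monotone b) (ha' : Measurable a) (hb' : Measurable b)
    (ν : Measure Ω2) [IsProbabilityMeasure ν] {δ : ℝ}
    (hδa : ∀ v, ν.real ((fun p => a p.1) ⁻¹' {v}) ≤ δ)
    (hδb : ∀ v, ν.real ((fun p => b p.2) ⁻¹' {v}) ≤ δ) (hδ : 0 ≤ δ) :
    |tPat σ ν - ∫ w, hPat σ (fun i => gridPoint (w i))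
      ∂(Measure.pi fun _ : Fin k => ν.map fun p => (a p.1, b p.2))| ≤ 2 * k ^ 2 * δ := by
  have hc : Measurable fun p : Ω2 => (a p.1, b p.2) := by fun_prop
  have : IsProbabilityMeasure (ν.map fun p => (a p.1, b p.2)) :=
    Measure.isProbabilityMeasure_map hc.aemeasurable
  have hmw : Measurable fun (w : Fin k → Fin M × Fin N) i => gridPoint (w i) :=
    measurable_of_finite _
  have hcz : Measurable fun (z : Fin k → Ω2) i => (a (z i).1, b (z i).2) := by fun_prop
  have hmap : ∫ w, hPat σ (fun i => gridPoint (w i))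
      ∂(Measure.pi fun _ : Fin k => ν.map fun p => (a p.1, b p.2)) =
      ∫ z, hPat σ (fun i => gridPoint (a (z i).1, b (z i).2)) ∂(Measure.pi fun _ : Fin k => ν) := by
    rw [← Measure.pi_map_pi fun _ => hc.aemeasurable]
    exact integral_map hcz.aemeasurable ((measurable_hPat σ).comp hmw).aestronglyMeasurable
  have hi : Integrable (fun z => hPat σ z) (Measure.pi fun _ : Fin k => ν) :=
    integrable_hPat σ _ measurable_id
  have hi' : Integrable (fun z : Fin k → Ω2 => hPat σ (fun i => gridPoint (a (z i).1, b (z i).2)))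
      (Measure.pi fun _ : Fin k => ν) := integrable_hPat σ _ (hmw.comp hcz)
  rw [hmap, tPat, ← integral_sub hi hi']
  refine abs_integral_le_integral_abs.trans ?_
  have hA : ∀ p : Fin k × Fin k, MeasurableSet {z : Fin k → Ω2 | a (z p.1).1 = a (z p.2).1} :=
    fun p => measurableSet_eq_fun (by fun_prop) (by fun_prop)
  have hB : ∀ p : Fin k × Fin k, MeasurableSet {z : Fin k → Ω2 | b (z p.1).2 = b (z p.2).2} :=
    fun p => measurableSet_eq_fun (by fun_prop) (by fun_prop)
  have hiA : ∀ p : Fin k × Fin k, Integrable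
      ({z : Fin k → Ω2 | a (z p.1).1 = a (z p.2).1}.indicator (1 : (Fin k → Ω2) → ℝ))
      (Measure.pi fun _ : Fin k => ν) := fun p => (integrable_const (1 : ℝ)).indicator (hA p)
  have hiB : ∀ p : Fin k × Fin k, Integrable
      ({z : Fin k → Ω2 | b (z p.1).2 = b (z p.2).2}.indicator (1 : (Fin k → Ω2) → ℝ))
      (Measure.pi fun _ : Fin k => ν) := fun p => (integrable_const (1 : ℝ)).indicator (hB p)
  have hiAB : ∀ p : Fin k × Fin k, Integrable (fun z =>
      {z : Fin k → Ω2 | a (z p.1).1 = a (z p.2).1}.indicator (1 : (Fin k → Ω2) → ℝ) z +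
        {z : Fin k → Ω2 | b (z p.1).2 = b (z p.2).2}.indicator (1 : (Fin k → Ω2) → ℝ) z)
      (Measure.pi fun _ : Fin k => ν) := fun p => (hiA p).add (hiB p)
  refine (integral_mono_of_nonneg (Eventually.of_forall fun z => abs_nonneg _)
    (integrable_finsetSum _ fun p _ => hiAB p)
    (Eventually.of_forall fun z => abs_hPat_sub_hPat_grid_le σ ha hb z)).trans ?_
  rw [integral_finsetSum _ fun p _ => hiAB p]
  calc _ ≤ ∑ p ∈ (Finset.univ : Finset (Fin k)).offDiag, (2 * δ) := by
        refine Finset.sum_le_sum fun p hp => ?_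
        have hp' : p.1 ≠ p.2 := by simpa using hp
        rw [integral_add (hiA p) (hiB p), integral_indicator_one (hA p),
          integral_indicator_one (hB p)]
        have h1 := measureReal_tie_le (a := fun p : Ω2 => a p.1) ν (by fun_prop) hδa hp'
        have h2 := measureReal_tie_le (a := fun p : Ω2 => b p.2) ν (by fun_prop) hδb hp'
        linarith
    _ = ((Finset.univ : Finset (Fin k)).offDiag.card : ℝ) * (2 * δ) := by simp
    _ ≤ (k : ℝ) ^ 2 * (2 * δ) := by
        gcongr
        rw [Finset.offDiag_card, Finset.card_univ, Fintype.card_fin, sq]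
        exact_mod_cast Nat.sub_le _ _
    _ = _ := by ring

lemma abs_tPat_sub_tPat_le {k M N : ℕ} (σ : Equiv.Perm (Fin k)) {a : ℝ → Fin M}
    {b : ℝ → Fin N} (ha : Monotone a) (hb : Monotone b) (ha' : Measurable a) (hb' : Measurable b)
    (ν ρ : Measure Ω2) [IsProbabilityMeasure ν] [IsProbabilityMeasure ρ] {δ : ℝ}
    (hδa : ∀ v, ν.real ((fun p => a p.1) ⁻¹' {v}) ≤ δ)
    (hδb : ∀ v, ν.real ((fun p => b p.2) ⁻¹' {v}) ≤ δ) (hδ : 0 ≤ δ)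
    (h : ρ.map (fun p => (a p.1, b p.2)) = ν.map (fun p => (a p.1, b p.2))) :
    |tPat σ ρ - tPat σ ν| ≤ 4 * k ^ 2 * δ := by
  have hc : Measurable fun p : Ω2 => (a p.1, b p.2) := by fun_prop
  have hA : ∀ v, ρ.real ((fun p => a p.1) ⁻¹' {v}) = ν.real ((fun p => a p.1) ⁻¹' {v}) := by
    intro v
    have := congrArg (fun m => m.real (Prod.fst ⁻¹' {v})) h
    rwa [map_measureReal_apply hc (measurable_fst (measurableSet_singleton v)),
      map_measureReal_apply hc (measurable_fst (measurableSet_singleton v))] at this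
  have hB : ∀ v, ρ.real ((fun p => b p.2) ⁻¹' {v}) = ν.real ((fun p => b p.2) ⁻¹' {v}) := by
    intro v
    have := congrArg (fun m => m.real (Prod.snd ⁻¹' {v})) h
    rwa [map_measureReal_apply hc (measurable_snd (measurableSet_singleton v)),
      map_measureReal_apply hc (measurable_snd (measurableSet_singleton v))] at this
  have h1 := abs_tPat_sub_integral_grid_le σ ha hb ha' hb' ν hδa hδb hδ
  have h2 := abs_tPat_sub_integral_grid_le σ ha hb ha' hb' ρ (fun v => (hA v).le.trans (hδa v))
    (fun v => (hB v).le.trans (hδb v)) hδ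
  rw [h] at h2
  rw [abs_sub_comm] at h1
  refine (abs_sub_le _ _ _).trans ((add_le_add h2 h1).trans (le_of_eq (by ring)))

lemma exists_monotone_fine_partition (ρ : Measure ℝ) [IsProbabilityMeasure ρ]
    (hρ : ∀ x, ρ {x} = 0) {m : ℕ} (hm : 0 < m) :
    ∃ (M : ℕ) (a : ℝ → Fin M), Monotone a ∧ Measurable a ∧
      ∀ v, ρ.real (a ⁻¹' {v}) ≤ 1 / m := by
  have hm' : (0 : ℝ) < m := by exact_mod_cast hm
  have hFm : Monotone fun x => ρ.real (Set.Iic x) := fun x y hxy =>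
    measureReal_mono (Set.Iic_subset_Iic.2 hxy)
  have hF1 : ∀ x, ρ.real (Set.Iic x) ≤ 1 := fun x => measureReal_le_one
  have hfl : Monotone fun x => ⌊m * ρ.real (Set.Iic x)⌋₊ := fun x y hxy =>
    Nat.floor_mono (mul_le_mul_of_nonneg_left (hFm hxy) hm'.le)
  have hlt : ∀ x, ⌊m * ρ.real (Set.Iic x)⌋₊ < m + 1 := fun x => by
    rw [Nat.lt_succ_iff]
    exact Nat.floor_le_of_le (by nlinarith [hF1 x])
  have hmono : Monotone fun x => (⟨⌊m * ρ.real (Set.Iic x)⌋₊, hlt x⟩ : Fin (m + 1)) :=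
    fun x y hxy => hfl hxy
  have hmeas : Measurable fun x => (⟨⌊m * ρ.real (Set.Iic x)⌋₊, hlt x⟩ : Fin (m + 1)) := by
    refine measurable_to_countable' fun v => ?_
    have : (fun x => (⟨⌊m * ρ.real (Set.Iic x)⌋₊, hlt x⟩ : Fin (m + 1))) ⁻¹' {v} =
        (fun x => ⌊m * ρ.real (Set.Iic x)⌋₊) ⁻¹' {(v : ℕ)} := by
      ext x; simp [Fin.ext_iff]
    rw [this]
    exact (Nat.measurable_floor.comp (measurable_const.mul hFm.measurable))
      (measurableSet_singleton _)
  refine ⟨m + 1, _, hmono, hmeas, fun v => ?_⟩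
  have key : ρ ((fun x => (⟨⌊m * ρ.real (Set.Iic x)⌋₊, hlt x⟩ : Fin (m + 1))) ⁻¹' {v}) ≤
      ENNReal.ofReal (1 / m) := by
    rw [(hmeas (measurableSet_singleton v)).measure_eq_iSup_isCompact]
    refine iSup₂_le fun K hK => iSup_le fun hKc => ?_
    rcases K.eq_empty_or_nonempty with rfl | hne
    · simp
    have hx := hK (hKc.sInf_mem hne)
    have hy := hK (hKc.sSup_mem hne)
    simp only [Set.mem_preimage, Set.mem_singleton_iff] at hx hy
    have hxy := congrArg Fin.val (hx.trans hy.symm)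
    simp only at hxy
    set x := sInf K
    set y := sSup K
    have hle : x ≤ y := csInf_le_csSup hne hKc.bddBelow hKc.bddAbove
    have hKs : K ⊆ Set.Icc x y := fun w hw =>
      ⟨csInf_le hKc.bddBelow hw, le_csSup hKc.bddAbove hw⟩
    have h1 := Nat.floor_le (a := m * ρ.real (Set.Iic x)) (by positivity)
    have h2 := Nat.lt_floor_add_one (m * ρ.real (Set.Iic y))
    rw [← hxy] at h2
    have h3 : ρ.real (Set.Iic x) + ρ.real (Set.Ioc x y) = ρ.real (Set.Iic y) := by
      rw [← measureReal_union _ measurableSet_Ioc, Set.Iic_union_Ioc_eq_Iic hle]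
      exact Set.Iic_disjoint_Ioc le_rfl
    have h4 : ρ (Set.Icc x y) ≤ ρ (Set.Ioc x y) := by
      rw [← Set.Ioc_insert_left hle, Set.insert_eq]
      refine (measure_union_le _ _).trans ?_
      rw [hρ, zero_add]
    refine (measure_mono hKs).trans (h4.trans ?_)
    rw [← ofReal_measureReal]
    refine ENNReal.ofReal_le_ofReal ?_
    rw [le_div_iff₀ hm']
    nlinarith
  exact ENNReal.toReal_le_of_le_ofReal (by positivity) key

/-- The empirical measure of a finite family of points of the plane. -/
def empMeas {n : ℕ} (z : Fin n → Ω2) : Measure Ω2 :=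
  (n : ℝ≥0∞)⁻¹ • ∑ i : Fin n, Measure.dirac (z i)

/-- The `V`-statistic of the pattern `σ` evaluated at `n` points of the plane. -/
def vStat {k n : ℕ} (σ : Equiv.Perm (Fin k)) (z : Fin n → Ω2) : ℝ :=
  ((n : ℝ)⁻¹) ^ k * ∑ f : Fin k → Fin n, hPat σ (fun i => z (f i))

lemma measurable_vStat {k n : ℕ} (σ : Equiv.Perm (Fin k)) :
    Measurable (vStat σ : (Fin n → Ω2) → ℝ) := by
  refine measurable_const.mul (Finset.measurable_sum _ fun f _ => ?_)
  exact (measurable_hPat σ).comp (by fun_prop)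

lemma isProbabilityMeasure_empMeas {n : ℕ} (hn : 0 < n) (z : Fin n → Ω2) :
    IsProbabilityMeasure (empMeas z) := by
  constructor
  simp only [empMeas, Measure.smul_apply, Measure.finsetSum_apply, measure_univ, smul_eq_mul]
  simp only [Finset.sum_const, Finset.card_univ, Fintype.card_fin, nsmul_eq_mul, mul_one]
  exact ENNReal.inv_mul_cancel (by exact_mod_cast hn.ne') (ENNReal.natCast_ne_top n)

lemma tPat_empMeas {k n : ℕ} (hn : 0 < n) (σ : Equiv.Perm (Fin k)) (z : Fin n → Ω2) :
    tPat σ (empMeas z) = vStat σ z := by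
  set u : Measure (Fin n) := (n : ℝ≥0∞)⁻¹ • ∑ i : Fin n, Measure.dirac i with hu
  have hz : Measurable z := measurable_of_finite z
  have hmap : u.map z = empMeas z := by
    ext s hs
    rw [Measure.map_apply hz hs]
    simp only [hu, empMeas, Measure.smul_apply, Measure.finsetSum_apply,
      Measure.dirac_apply' _ hs, Measure.dirac_apply' _ (hz hs)]
    rfl
  have hus : ∀ i, u {i} = (n : ℝ≥0∞)⁻¹ := by
    intro i
    simp only [hu, Measure.smul_apply, Measure.finsetSum_apply, smul_eq_mul]
    simp [Set.indicator, eq_comm]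
  have : IsProbabilityMeasure (u.map z) := hmap ▸ isProbabilityMeasure_empMeas hn z
  have : IsProbabilityMeasure u := Measure.isProbabilityMeasure_of_map z
  have hzf : Measurable fun (f : Fin k → Fin n) i => z (f i) := measurable_of_finite _
  rw [tPat, ← hmap, ← Measure.pi_map_pi fun _ => hz.aemeasurable,
    integral_map hzf.aemeasurable (measurable_hPat σ).aestronglyMeasurable,
    integral_fintype (integrable_hPat σ _ hzf), vStat, Finset.mul_sum]
  refine Finset.sum_congr rfl fun f _ => ?_
  simp [measureReal_def, Measure.pi_singleton, hus]

lemma vStat_nonneg {k n : ℕ} (σ : Equiv.Perm (Fin k)) (z : Fin n → Ω2) : 0 ≤ vStat σ z :=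
  mul_nonneg (by positivity) (Finset.sum_nonneg fun _ _ => hPat_nonneg _ _)

lemma vStat_le_one {k n : ℕ} (hn : 0 < n) (σ : Equiv.Perm (Fin k)) (z : Fin n → Ω2) :
    vStat σ z ≤ 1 := by
  have := isProbabilityMeasure_empMeas hn z
  rw [← tPat_empMeas hn]
  exact tPat_le_one _ _

lemma exists_hPat_eq_one {n : ℕ} {z : Fin n → Ω2} (h₁ : Function.Injective fun i => (z i).1)
    (h₂ : Function.Injective fun i => (z i).2) : ∃ π : Equiv.Perm (Fin n), hPat π z = 1 := by
  set τ := Tuple.sort fun i => (z i).1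
  set ρ := Tuple.sort fun i => (z i).2
  refine ⟨(τ⁻¹ * ρ)⁻¹, if_pos ⟨τ, ?_, ?_⟩⟩
  · exact (Tuple.monotone_sort fun i => (z i).1).strictMono_of_injective
      (h₁.comp τ.injective)
  · have := (Tuple.monotone_sort fun i => (z i).2).strictMono_of_injective
      (h₂.comp ρ.injective)
    simpa [Function.comp_def] using this

lemma tPerm_inducedPerm {k n : ℕ} (hn : 0 < n) (σ : Equiv.Perm (Fin k)) {z : Fin n → Ω2}
    (h₁ : Function.Injective fun i => (z i).1) (h₂ : Function.Injective fun i => (z i).2) :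
    tPerm σ (inducedPerm z) = vStat σ z := by
  have hex := exists_hPat_eq_one h₁ h₂
  have hπ : hPat (inducedPerm z) z = 1 := by
    rw [inducedPerm, dif_pos hex]
    exact hex.choose_spec
  generalize inducedPerm z = π at hπ
  obtain ⟨τ, hx, hy⟩ : ∃ τ : Equiv.Perm (Fin n), StrictMono (fun i => (z (τ i)).1) ∧
      StrictMono (fun i => (z (τ (π⁻¹ i))).2) := by
    by_contra hcon
    rw [hPat, if_neg hcon] at hπ
    exact zero_ne_one hπ
  have hn' : (0 : ℝ) < n := by exact_mod_cast hn
  have hE : tPerm σ π = vStat σ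
      fun i : Fin n => ((((i : ℕ) + 1 : ℝ)) / n, (((π i : ℕ) + 1 : ℝ)) / n) :=
    tPat_empMeas hn σ _
  rw [hE, vStat, vStat, ← Equiv.sum_comp ((Equiv.refl (Fin k)).arrowCongr τ)
    fun f => hPat σ fun i => z (f i)]
  congr 1
  refine Finset.sum_congr rfl fun f _ => hPat_congr σ (fun i j => ?_) (fun i j => ?_)
  · have := hx.lt_iff_lt (a := f i) (b := f j)
    simp [div_lt_div_iff_of_pos_right hn', this]
  · have := hy.lt_iff_lt (a := π (f i)) (b := π (f j))
    simp only [Equiv.Perm.inv_def, Equiv.symm_apply_apply] at this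
    simp [div_lt_div_iff_of_pos_right hn', this]

lemma ae_injective_of_atomless {α ι : Type*} [MeasurableSpace α] [Fintype ι]
    (ν : Measure α) [IsProbabilityMeasure ν] {c : α → ℝ} (hc : Measurable c)
    (hatom : ∀ x, ν.map c {x} = 0) :
    ∀ᵐ z ∂(Measure.pi fun _ : ι => ν), Function.Injective fun i => c (z i) := by
  have : IsProbabilityMeasure (ν.map c) := Measure.isProbabilityMeasure_map hc.aemeasurable
  have hpair : ∀ i j : ι, i ≠ j → ∀ᵐ z ∂(Measure.pi fun _ : ι => ν), c (z i) ≠ c (z j) := by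
    intro i j hij
    have hle : ∀ m : ℕ, (Measure.pi fun _ : ι => ν).real {z | c (z i) = c (z j)} ≤
        1 / ((m : ℝ) + 1) := by
      intro m
      obtain ⟨M, a, -, ha, hsm⟩ := exists_monotone_fine_partition (ν.map c) hatom m.succ_pos
      refine le_trans (measureReal_mono fun z (hz : c (z i) = c (z j)) => ?_)
        (measureReal_tie_le ν (ha.comp hc) (fun v => ?_) hij)
      · exact congrArg a hz
      · have := hsm v
        rw [map_measureReal_apply hc (ha (measurableSet_singleton v))] at this
        exact_mod_cast this
    have h0 : (Measure.pi fun _ : ι => ν).real {z | c (z i) = c (z j)} ≤ 0 :=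
      ge_of_tendsto' tendsto_one_div_add_atTop_nhds_zero_nat hle
    rw [ae_iff]
    simpa [measureReal_eq_zero_iff] using le_antisymm h0 measureReal_nonneg
  have hall : ∀ᵐ z ∂(Measure.pi fun _ : ι => ν), ∀ i j : ι, i ≠ j → c (z i) ≠ c (z j) := by
    simpa only [ae_all_iff] using hpair
  filter_upwards [hall] with z hz i j hij
  by_contra hne
  exact hz i j hne hij

lemma ae_tPerm_inducedPerm {k n : ℕ} (hn : 0 < n) (σ : Equiv.Perm (Fin k))
    {μ : ProbabilityMeasure Ω2} (hμ : μ ∈ Mcal) :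
    ∀ᵐ z ∂pmeas (μ : Measure Ω2) n, tPerm σ (inducedPerm z) = vStat σ z := by
  filter_upwards [ae_injective_of_atomless (ι := Fin n) (μ : Measure Ω2) measurable_fst hμ.2.1,
    ae_injective_of_atomless (ι := Fin n) (μ : Measure Ω2) measurable_snd hμ.2.2] with z h₁ h₂
  exact tPerm_inducedPerm hn σ h₁ h₂

lemma Fn_eq_log_integral_vStat {k n : ℕ} (hn : 0 < n) (σ : Equiv.Perm (Fin k))
    {μ : ProbabilityMeasure Ω2} (hμ : μ ∈ Mcal) (θ : ℝ) :
    Fn σ (μ : Measure Ω2) θ n =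
      Real.log (∫ z, Real.exp (n * θ * vStat σ z) ∂pmeas (μ : Measure Ω2) n) := by
  rw [Fn]
  congr 1
  refine integral_congr_ae ?_
  filter_upwards [ae_tPerm_inducedPerm hn σ hμ] with z hz
  rw [hz]

lemma integrable_mul_log_of_lintegral_ne_top {α : Type*} [MeasurableSpace α] {μ : Measure α}
    [IsProbabilityMeasure μ] {g : α → ℝ} (hg : Measurable g) (hg0 : ∀ x, 0 ≤ g x)
    (hgi : Integrable g μ) (hg1 : ∫ x, g x ∂μ = 1)
    (hfin : ∫⁻ x, ENNReal.ofReal (g x * Real.log (g x) + 1 - g x) ∂μ ≠ ∞) :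
    Integrable (fun x => g x * Real.log (g x)) μ ∧
      ∫ x, g x * Real.log (g x) ∂μ =
        (∫⁻ x, ENNReal.ofReal (g x * Real.log (g x) + 1 - g x) ∂μ).toReal := by
  have hm : Measurable fun x => g x * Real.log (g x) + 1 - g x := by fun_prop
  have hnn : ∀ x, 0 ≤ g x * Real.log (g x) + 1 - g x := fun x =>
    InformationTheory.klFun_nonneg (hg0 x)
  have hφ : Integrable (fun x => g x * Real.log (g x) + 1 - g x) μ :=
    (lintegral_ofReal_ne_top_iff_integrable hm.aestronglyMeasurable
      (Eventually.of_forall hnn)).1 hfin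
  have hrest : Integrable (fun x => 1 - g x) μ := (integrable_const _).sub hgi
  have heq : (fun x => g x * Real.log (g x)) =
      fun x => (g x * Real.log (g x) + 1 - g x) - (1 - g x) := by funext x; ring
  refine ⟨heq ▸ hφ.sub hrest, ?_⟩
  rw [heq, integral_sub hφ hrest, integral_sub (integrable_const _) hgi, hg1,
    integral_eq_lintegral_of_nonneg_ae (Eventually.of_forall hnn) hm.aestronglyMeasurable]
  simp

/-- A power of a measure with a density is the power of the base measure with the product
density. -/
lemma pi_withDensity_ofReal {α ι : Type*} [MeasurableSpace α] [Fintype ι] {μ : Measure α}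
    [IsProbabilityMeasure μ] {g : α → ℝ} (hg0 : ∀ x, 0 ≤ g x)
    (hgi : Integrable g μ) :
    (Measure.pi fun _ : ι => μ).withDensity (fun z => ENNReal.ofReal (∏ i, g (z i))) =
      Measure.pi fun _ : ι => μ.withDensity fun x => ENNReal.ofReal (g x) := by
  have : IsFiniteMeasure (μ.withDensity fun x => ENNReal.ofReal (g x)) :=
    isFiniteMeasure_withDensity_ofReal hgi.2
  have hint : ∀ s : Set α, MeasurableSet s →
      (μ.withDensity fun x => ENNReal.ofReal (g x)) s =
        ENNReal.ofReal (∫ x, s.indicator g x ∂μ) := by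
    intro s hs
    rw [withDensity_apply _ hs, integral_indicator hs,
      ofReal_integral_eq_lintegral_ofReal hgi.integrableOn (Eventually.of_forall hg0)]
  symm
  refine Measure.pi_eq fun s hs => ?_
  have hmp : Integrable (fun z : ι → α => ∏ i, g (z i)) (Measure.pi fun _ : ι => μ) :=
    Integrable.fintype_prod (f := fun _ => g) fun _ => hgi
  simp only [hint _ (hs _)]
  rw [withDensity_apply _ (MeasurableSet.univ_pi hs),
    ← ofReal_integral_eq_lintegral_ofReal hmp.integrableOn
      (Eventually.of_forall fun z => Finset.prod_nonneg fun i _ => hg0 (z i)),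
    ← integral_indicator (MeasurableSet.univ_pi hs),
    ← ENNReal.ofReal_prod_of_nonneg fun i _ =>
      integral_nonneg fun x => Set.indicator_nonneg (fun x _ => hg0 x) x,
    ← integral_fintype_prod_eq_prod]
  congr 2
  funext z
  by_cases hz : z ∈ Set.univ.pi s
  · rw [Set.indicator_of_mem hz]
    exact Finset.prod_congr rfl fun i _ => (Set.indicator_of_mem (hz i trivial) g).symm
  · rw [Set.indicator_of_notMem hz]
    simp only [Set.mem_pi, not_forall] at hz
    obtain ⟨i, -, hi⟩ := hz
    exact (Finset.prod_eq_zero (Finset.mem_univ i) (Set.indicator_of_notMem hi g)).symm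

lemma integral_vStat {k n : ℕ} (σ : Equiv.Perm (Fin k)) (ν : Measure Ω2)
    [IsProbabilityMeasure ν] :
    ∫ z, vStat σ z ∂(Measure.pi fun _ : Fin n => ν) =
      (n.descFactorial k : ℝ) / (n : ℝ) ^ k * tPat σ ν := by
  classical
  have hterm : ∀ f : Fin k → Fin n, ∫ z, hPat σ (fun i => z (f i))
      ∂(Measure.pi fun _ : Fin n => ν) = if Function.Injective f then tPat σ ν else 0 := by
    intro f
    split_ifs with hf
    · have hm : Measurable fun (z : Fin n → Ω2) i => z (f i) := by fun_prop
      rw [tPat, ← pi_map_comp_injective ν hf, integral_map hm.aemeasurable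
        (measurable_hPat σ).aestronglyMeasurable]
    · have : ∀ z : Fin n → Ω2, hPat σ (fun i => z (f i)) = 0 := fun z =>
        hPat_eq_zero_of_not_injective σ fun h => hf (Function.Injective.of_comp (f := z) h)
      simp [this]
  have hcard : (Finset.univ.filter fun f : Fin k → Fin n => Function.Injective f).card =
      n.descFactorial k := by
    rw [← Fintype.card_subtype, Fintype.card_congr (Equiv.subtypeInjectiveEquivEmbedding _ _),
      Fintype.card_embedding_eq, Fintype.card_fin, Fintype.card_fin]
  simp only [vStat]
  rw [integral_const_mul, integral_finsetSum _ fun f _ => integrable_hPat σ _ (by fun_prop)]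
  simp only [hterm]
  rw [← Finset.sum_filter, Finset.sum_const, hcard, nsmul_eq_mul, inv_pow]
  ring

lemma le_log_integral_exp_vStat {k n : ℕ} (hn : 0 < n) (σ : Equiv.Perm (Fin k))
    {μ ν : Measure Ω2} [IsProbabilityMeasure μ] [IsProbabilityMeasure ν] (hKL : KL ν μ ≠ ∞)
    (θ : ℝ) :
    n * (θ * ((n.descFactorial k : ℝ) / (n : ℝ) ^ k * tPat σ ν) - (KL ν μ).toReal) ≤
      Real.log (∫ z, Real.exp (n * θ * vStat σ z) ∂pmeas μ n) := by
  have hac : ν ≪ μ := by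
    by_contra h
    exact hKL (if_neg h)
  rw [KL, if_pos hac] at hKL ⊢
  set g : Ω2 → ℝ := fun z => (ν.rnDeriv μ z).toReal with hgdef
  have hg : Measurable g := (Measure.measurable_rnDeriv ν μ).ennreal_toReal
  have hg0 : ∀ x, 0 ≤ g x := fun x => ENNReal.toReal_nonneg
  have hgi : Integrable g μ := Measure.integrable_toReal_rnDeriv
  have hg1 : ∫ x, g x ∂μ = 1 := by simp [hgdef, Measure.integral_toReal_rnDeriv hac]
  obtain ⟨hli, hl⟩ := integrable_mul_log_of_lintegral_ne_top hg hg0 hgi hg1 hKL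
  rw [← hl]
  set D := ∫ x, g x * Real.log (g x) ∂μ
  have hν : μ.withDensity (fun x => ENNReal.ofReal (g x)) = ν := by
    rw [← Measure.withDensity_rnDeriv_eq ν μ hac]
    refine withDensity_congr_ae ?_
    filter_upwards [Measure.rnDeriv_lt_top ν μ] with x hx
    exact ENNReal.ofReal_toReal hx.ne
  set P : Measure (Fin n → Ω2) := pmeas μ n with hP
  have : IsProbabilityMeasure P := by rw [hP, pmeas]; infer_instance
  have hpd : P.withDensity (fun z => ENNReal.ofReal (∏ i, g (z i))) =
      Measure.pi fun _ : Fin n => ν := by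
    have := pi_withDensity_ofReal (ι := Fin n) hg0 hgi
    rwa [hν] at this
  have hG0 : ∀ z : Fin n → Ω2, 0 ≤ ∏ i, g (z i) := fun z => Finset.prod_nonneg fun i _ => hg0 _
  have hGi : Integrable (fun z : Fin n → Ω2 => ∏ i, g (z i)) P :=
    Integrable.fintype_prod (f := fun _ => g) fun _ => hgi
  have hG1 : ∫ z, ∏ i, g (z i) ∂P = 1 := by
    have := integral_fintype_prod_eq_pow (ι := Fin n) (μ := μ) g
    rw [hg1, one_pow] at this
    exact this
  have hVbd : ∀ z : Fin n → Ω2, ‖vStat σ z‖ ≤ 1 := fun z => by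
    rw [Real.norm_of_nonneg (vStat_nonneg σ z)]; exact vStat_le_one hn σ z
  have hGVi : Integrable (fun z => (∏ i, g (z i)) * vStat σ z) P :=
    hGi.mul_bdd (c := 1) (measurable_vStat σ).aestronglyMeasurable (Eventually.of_forall hVbd)
  have hGV : ∫ z, (∏ i, g (z i)) * vStat σ z ∂P =
      (n.descFactorial k : ℝ) / (n : ℝ) ^ k * tPat σ ν := by
    rw [← integral_vStat, ← hpd, integral_withDensity_eq_integral_toReal_smul
      (by fun_prop) (Eventually.of_forall fun z => ENNReal.ofReal_lt_top)]
    refine integral_congr_ae (Eventually.of_forall fun z => ?_)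
    simp [ENNReal.toReal_ofReal (hG0 z)]
  have hprod : ∀ i : Fin n, (fun z : Fin n → Ω2 => (∏ j, g (z j)) * Real.log (g (z i))) =
      fun z => ∏ j, (fun x => if j = i then g x * Real.log (g x) else g x) (z j) := by
    intro i
    funext z
    rw [← Finset.mul_prod_erase Finset.univ (fun j => g (z j)) (Finset.mem_univ i),
      ← Finset.mul_prod_erase Finset.univ
        (fun j => (fun x => if j = i then g x * Real.log (g x) else g x) (z j))
        (Finset.mem_univ i)]
    simp only [if_true]
    rw [mul_right_comm]
    congr 1
    exact Finset.prod_congr rfl fun j hj => by rw [if_neg (Finset.ne_of_mem_erase hj)]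
  have hGLi : ∀ i : Fin n,
      Integrable (fun z : Fin n → Ω2 => (∏ j, g (z j)) * Real.log (g (z i))) P := by
    intro i
    rw [hprod i]
    refine Integrable.fintype_prod (μ := fun _ => μ)
      (f := fun (j : Fin n) x => if j = i then g x * Real.log (g x) else g x) fun j => ?_
    by_cases h : j = i
    · simpa [h] using hli
    · simpa [h] using hgi
  have hGL : ∀ i : Fin n, ∫ z, (∏ j, g (z j)) * Real.log (g (z i)) ∂P = D := by
    intro i
    rw [hprod i, hP, pmeas, integral_fintype_prod_eq_prod (μ := fun _ => μ)
      (fun (j : Fin n) x => if j = i then g x * Real.log (g x) else g x),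
      ← Finset.mul_prod_erase _ _ (Finset.mem_univ i)]
    rw [Finset.prod_eq_one fun j hj => ?_]
    · simp [D]
    · simp [Finset.ne_of_mem_erase hj, hg1]
  set A := n * (θ * ((n.descFactorial k : ℝ) / (n : ℝ) ^ k * tPat σ ν) - D) with hA
  have hpt : ∀ z : Fin n → Ω2, (∏ i, g (z i)) * (1 - A) +
      n * θ * ((∏ i, g (z i)) * vStat σ z) - ∑ i, (∏ j, g (z j)) * Real.log (g (z i)) ≤
      Real.exp (-A) * Real.exp (n * θ * vStat σ z) := by
    intro z
    rcases (hG0 z).eq_or_lt with h0 | hpos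
    · simp only [← h0, zero_mul, mul_zero, Finset.sum_const_zero, add_zero, sub_zero]
      positivity
    · have hne : ∀ i ∈ (Finset.univ : Finset (Fin n)), g (z i) ≠ 0 :=
        Finset.prod_ne_zero_iff.1 hpos.ne'
      rw [← Finset.mul_sum, ← Real.log_prod hne]
      set G := ∏ i, g (z i)
      have hE : Real.exp (-A) * Real.exp (n * θ * vStat σ z) =
          G * Real.exp (n * θ * vStat σ z - Real.log G - A) := by
        rw [show n * θ * vStat σ z - Real.log G - A = (-A + n * θ * vStat σ z) - Real.log G by
          ring, Real.exp_sub, Real.exp_add, Real.exp_log hpos]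
        field_simp
      rw [hE]
      have := Real.add_one_le_exp (n * θ * vStat σ z - Real.log G - A)
      nlinarith
  have hVi : Integrable (fun z : Fin n → Ω2 => Real.exp (n * θ * vStat σ z)) P := by
    refine Integrable.of_bound (Real.measurable_exp.comp
      (measurable_const.mul (measurable_vStat σ))).aestronglyMeasurable (Real.exp |n * θ|)
      (Eventually.of_forall fun z => ?_)
    rw [Real.norm_eq_abs, Real.abs_exp, Real.exp_le_exp]
    refine (le_abs_self _).trans ?_
    rw [abs_mul]
    exact mul_le_of_le_one_right (abs_nonneg _) (hVbd z)
  have hI1 : Integrable (fun z : Fin n → Ω2 => (∏ i, g (z i)) * (1 - A)) P := hGi.mul_const _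
  have hI2 : Integrable (fun z : Fin n → Ω2 => n * θ * ((∏ i, g (z i)) * vStat σ z)) P :=
    hGVi.const_mul _
  have hI3 : Integrable
      (fun z : Fin n → Ω2 => ∑ i, (∏ j, g (z j)) * Real.log (g (z i))) P :=
    integrable_finsetSum _ fun i _ => hGLi i
  have hI12 : Integrable (fun z : Fin n → Ω2 => (∏ i, g (z i)) * (1 - A) +
      n * θ * ((∏ i, g (z i)) * vStat σ z)) P := hI1.add hI2
  have hint := integral_mono (hI12.sub hI3) (hVi.const_mul (Real.exp (-A))) hpt
  simp only [Pi.sub_apply] at hint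
  rw [integral_sub hI12 hI3, integral_add hI1 hI2, integral_mul_const, integral_const_mul,
    integral_const_mul, hG1, hGV, integral_finsetSum _ fun i _ => hGLi i] at hint
  simp only [hGL, Finset.sum_const, Finset.card_univ, Fintype.card_fin, nsmul_eq_mul] at hint
  have hone : 1 ≤ Real.exp (-A) * ∫ z, Real.exp (n * θ * vStat σ z) ∂P := by
    refine le_trans (le_of_eq ?_) hint
    rw [hA]; ring
  have hexp : Real.exp A ≤ ∫ z, Real.exp (n * θ * vStat σ z) ∂P := by
    rw [Real.exp_neg] at hone
    have := Real.exp_pos A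
    rwa [inv_mul_eq_div, le_div_iff₀ this, one_mul] at hone
  exact (Real.le_log_iff_exp_le ((Real.exp_pos A).trans_le hexp)).2 hexp

lemma mem_Mcal_of_absolutelyContinuous {μ ν : ProbabilityMeasure Ω2} (hμ : μ ∈ Mcal)
    (h : (ν : Measure Ω2) ≪ (μ : Measure Ω2)) : ν ∈ Mcal := by
  have hsq : MeasurableSet unitSq := measurableSet_Icc.prod measurableSet_Icc
  refine ⟨?_, fun x => (h.map measurable_fst) (hμ.2.1 x),
    fun y => (h.map measurable_snd) (hμ.2.2 y)⟩
  have h1 : (μ : Measure Ω2) unitSq = 1 := hμ.1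
  exact (prob_compl_eq_zero_iff hsq).1 (h ((prob_compl_eq_zero_iff hsq).2 h1))

/-- An entropy bound for the mass that a measure puts on a set. -/
lemma mul_measureReal_le_KL_add {μ ν : Measure Ω2} [IsProbabilityMeasure μ]
    [IsProbabilityMeasure ν] (hKL : KL ν μ ≠ ∞) {s : Set Ω2} (hs : MeasurableSet s) (l : ℝ) :
    l * ν.real s ≤ (KL ν μ).toReal + Real.exp l * μ.real s := by
  have hac : ν ≪ μ := by
    by_contra h
    exact hKL (if_neg h)
  rw [KL, if_pos hac] at hKL ⊢
  set g : Ω2 → ℝ := fun z => (ν.rnDeriv μ z).toReal with hgdef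
  have hg : Measurable g := (Measure.measurable_rnDeriv ν μ).ennreal_toReal
  have hg0 : ∀ x, 0 ≤ g x := fun x => ENNReal.toReal_nonneg
  have hm : Measurable fun x => g x * Real.log (g x) + 1 - g x := by fun_prop
  have hnn : ∀ x, 0 ≤ g x * Real.log (g x) + 1 - g x := fun x =>
    InformationTheory.klFun_nonneg (hg0 x)
  have hφ : Integrable (fun x => g x * Real.log (g x) + 1 - g x) μ :=
    (lintegral_ofReal_ne_top_iff_integrable hm.aestronglyMeasurable
      (Eventually.of_forall hnn)).1 hKL
  have hφint : ∫ x, g x * Real.log (g x) + 1 - g x ∂μ =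
      (∫⁻ x, ENNReal.ofReal (g x * Real.log (g x) + 1 - g x) ∂μ).toReal :=
    integral_eq_lintegral_of_nonneg_ae (Eventually.of_forall hnn) hm.aestronglyMeasurable
  rw [← hφint, ← Measure.setIntegral_toReal_rnDeriv hac s, ← integral_indicator hs,
    ← integral_indicator_one hs, ← integral_const_mul, ← integral_const_mul]
  have hi1 : Integrable (fun x => Real.exp l * s.indicator (1 : Ω2 → ℝ) x) μ :=
    ((integrable_const (1 : ℝ)).indicator hs).const_mul _
  have hi2 : Integrable (fun x => l * s.indicator g x) μ :=
    (Measure.integrable_toReal_rnDeriv.indicator hs).const_mul _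
  rw [← integral_add hφ hi1]
  refine integral_mono hi2 (hφ.add hi1) fun x => ?_
  simp only
  by_cases hx : x ∈ s
  · simp only [Set.indicator_of_mem hx, Pi.one_apply, mul_one]
    change l * g x ≤ g x * Real.log (g x) + 1 - g x + Real.exp l
    rcases (hg0 x).eq_or_lt with h0 | hpos
    · rw [← h0, zero_mul, mul_zero]
      have := Real.exp_pos l
      linarith
    · have h1 := Real.add_one_le_exp (l - Real.log (g x))
      rw [Real.exp_sub, Real.exp_log hpos, le_div_iff₀ hpos] at h1
      nlinarith
  · simp only [Set.indicator_of_notMem hx, mul_zero, add_zero]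
    exact hnn x

section Types

variable {κ : Type*} [Fintype κ] [MeasurableSpace κ] [MeasurableSingletonClass κ]

lemma integral_comp_finite {α : Type*} [MeasurableSpace α] (μ : Measure α)
    [IsProbabilityMeasure μ] {c : α → κ} (hc : Measurable c) (F : κ → ℝ) :
    ∫ x, F (c x) ∂μ = ∑ j, μ.real (c ⁻¹' {j}) * F j := by
  have : IsProbabilityMeasure (μ.map c) := Measure.isProbabilityMeasure_map hc.aemeasurable
  have hF : Measurable F := measurable_of_finite F
  rw [← integral_map hc.aemeasurable hF.aestronglyMeasurable, integral_fintype .of_finite]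
  refine Finset.sum_congr rfl fun j _ => ?_
  rw [map_measureReal_apply hc (measurableSet_singleton j), smul_eq_mul]

lemma integrable_comp_finite {α : Type*} [MeasurableSpace α] (μ : Measure α)
    [IsProbabilityMeasure μ] {c : α → κ} (hc : Measurable c) (F : κ → ℝ) :
    Integrable (fun x => F (c x)) μ := by
  have : IsProbabilityMeasure (μ.map c) := Measure.isProbabilityMeasure_map hc.aemeasurable
  exact (Integrable.of_finite : Integrable F (μ.map c)).comp_measurable hc

/-- A finite distribution `p` on the cells of a partition lifts to a measure whose relative
entropy is that of `p`. -/
lemma exists_lift_of_weights {μ : Measure Ω2} [IsProbabilityMeasure μ] {c : Ω2 → κ}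
    (hc : Measurable c) {p : κ → ℝ} (hp0 : ∀ j, 0 ≤ p j) (hp1 : ∑ j, p j = 1)
    (hpq : ∀ j, μ.real (c ⁻¹' {j}) = 0 → p j = 0) :
    ∃ ν : ProbabilityMeasure Ω2, (ν : Measure Ω2) ≪ μ ∧ KL ν μ ≠ ∞ ∧
      (KL ν μ).toReal = ∑ j, p j * Real.log (p j / μ.real (c ⁻¹' {j})) ∧
      ∀ j, (ν : Measure Ω2).real (c ⁻¹' {j}) = p j := by
  set q : κ → ℝ := fun j => μ.real (c ⁻¹' {j}) with hq
  set G : κ → ℝ := fun j => p j / q j with hG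
  have hqG : ∀ j, q j * G j = p j := fun j => by
    by_cases h : q j = 0
    · rw [h, zero_mul, hpq j h]
    · exact mul_div_cancel₀ _ h
  have hG0 : ∀ j, 0 ≤ G j := fun j => div_nonneg (hp0 j) measureReal_nonneg
  have hGm : Measurable G := measurable_of_finite G
  have hg : Measurable fun x => G (c x) := hGm.comp hc
  have hgi : Integrable (fun x => G (c x)) μ := integrable_comp_finite μ hc G
  have hg1 : ∫ x, G (c x) ∂μ = 1 := by
    rw [integral_comp_finite μ hc, ← hp1]
    exact Finset.sum_congr rfl fun j _ => hqG j
  set ν := μ.withDensity fun x => ENNReal.ofReal (G (c x)) with hν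
  have hνs : ∀ s : Set Ω2, MeasurableSet s → ν s = ENNReal.ofReal (∫ x in s, G (c x) ∂μ) := by
    intro s hs
    rw [hν, withDensity_apply _ hs,
      ofReal_integral_eq_lintegral_ofReal hgi.integrableOn (Eventually.of_forall fun x => hG0 _)]
  have hprob : IsProbabilityMeasure ν := ⟨by
    rw [hνs _ MeasurableSet.univ, Measure.restrict_univ, hg1, ENNReal.ofReal_one]⟩
  have hac : ν ≪ μ := withDensity_absolutelyContinuous _ _
  have hrn : ∀ᵐ x ∂μ, (ν.rnDeriv μ x).toReal = G (c x) := by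
    filter_upwards [Measure.rnDeriv_withDensity μ hg.ennreal_ofReal] with x hx
    rw [hν, hx, ENNReal.toReal_ofReal (hG0 _)]
  have hKL : KL ν μ =
      ∫⁻ x, ENNReal.ofReal (G (c x) * Real.log (G (c x)) + 1 - G (c x)) ∂μ := by
    rw [KL, if_pos hac]
    refine lintegral_congr_ae ?_
    filter_upwards [hrn] with x hx
    rw [hx]
  have hKLtop : KL ν μ ≠ ∞ := by
    rw [hKL, ← ofReal_integral_eq_lintegral_ofReal
      (integrable_comp_finite μ hc fun j => G j * Real.log (G j) + 1 - G j)
      (Eventually.of_forall fun x => InformationTheory.klFun_nonneg (hG0 _))]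
    exact ENNReal.ofReal_ne_top
  refine ⟨⟨ν, hprob⟩, hac, hKLtop, ?_, fun j => ?_⟩
  · have h := (integrable_mul_log_of_lintegral_ne_top hg (fun x => hG0 _) hgi hg1
      (hKL ▸ hKLtop)).2
    rw [ProbabilityMeasure.coe_mk, hKL, ← h,
      integral_comp_finite μ hc fun j => G j * Real.log (G j)]
    refine Finset.sum_congr rfl fun j _ => ?_
    rw [← mul_assoc, show μ.real (c ⁻¹' {j}) * G j = p j from hqG j]
  · have hms : MeasurableSet (c ⁻¹' {j}) := hc (measurableSet_singleton j)
    have hcell : ∫ x in c ⁻¹' {j}, G (c x) ∂μ = p j := by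
      rw [setIntegral_congr_fun hms (g := fun _ => G j) fun x (hx : c x = j) => by simp only [hx],
        setIntegral_const, smul_eq_mul]
      exact hqG j
    rw [ProbabilityMeasure.coe_mk, measureReal_def, hνs _ hms, hcell,
      ENNReal.toReal_ofReal (hp0 j)]

end Types

lemma ae_cell_ne_zero {n : ℕ} {κ : Type*} [Fintype κ] (μ : Measure Ω2) [IsProbabilityMeasure μ]
    {c : Ω2 → κ} : ∀ᵐ z ∂pmeas μ n, ∀ i, μ.real (c ⁻¹' {c (z i)}) ≠ 0 := by
  have h1 : ∀ᵐ x ∂μ, μ.real (c ⁻¹' {c x}) ≠ 0 := by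
    have hnull : μ (⋃ j ∈ (Finset.univ.filter fun j => μ.real (c ⁻¹' {j}) = 0), c ⁻¹' {j}) = 0 := by
      refine (measure_biUnion_null_iff (Finset.countable_toSet _)).2 fun j hj => ?_
      simpa [measureReal_eq_zero_iff] using hj
    rw [ae_iff]
    refine measure_mono_null (fun x hx => ?_) hnull
    simp only [Set.mem_iUnion]
    exact ⟨c x, by simpa using hx, rfl⟩
  rw [ae_all_iff]
  intro i
  exact (measurePreserving_eval (fun _ : Fin n => μ) i).quasiMeasurePreserving.ae h1

open scoped Classical in
/-- The proportion of the points `z` that fall in the cell `j`. -/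
def cellFreq {n : ℕ} {κ : Type*} (c : Ω2 → κ) (z : Fin n → Ω2) (j : κ) : ℝ :=
  ((Finset.univ.filter fun i => c (z i) = j).card : ℝ) / n

lemma empMeas_real_cell {n : ℕ} {κ : Type*} [MeasurableSpace κ] [MeasurableSingletonClass κ]
    {c : Ω2 → κ} (hc : Measurable c) (z : Fin n → Ω2) (j : κ) :
    (empMeas z).real (c ⁻¹' {j}) = cellFreq c z j := by
  classical
  rw [measureReal_def, empMeas, cellFreq]
  simp only [Measure.smul_apply, Measure.finsetSum_apply, smul_eq_mul,
    Measure.dirac_apply' _ (hc (measurableSet_singleton j)), Set.indicator, Set.mem_preimage,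
    Set.mem_singleton_iff, Pi.one_apply, Finset.sum_boole]
  simp [div_eq_inv_mul]

lemma sum_cellFreq_mul {n : ℕ} {κ : Type*} [Fintype κ] (hn : 0 < n) (c : Ω2 → κ)
    (z : Fin n → Ω2) (F : κ → ℝ) : n * ∑ j, cellFreq c z j * F j = ∑ i, F (c (z i)) := by
  classical
  have hn' : (n : ℝ) ≠ 0 := by exact_mod_cast hn.ne'
  rw [Finset.mul_sum, ← Finset.sum_fiberwise_of_maps_to (s := Finset.univ) (t := Finset.univ)
    (g := fun i => c (z i)) (fun i _ => Finset.mem_univ _)]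
  refine Finset.sum_congr rfl fun j _ => ?_
  rw [Finset.sum_congr rfl fun i hi => by rw [(Finset.mem_filter.1 hi).2], Finset.sum_const,
    nsmul_eq_mul, cellFreq]
  field_simp

/-- The pattern statistic is controlled by the variational upper bound `S`, the mesh of the grid,
and the relative entropy of the cell frequencies. -/
lemma mul_vStat_le {k n M N m : ℕ} (hn : 0 < n) (hm : 2 ≤ m) (σ : Equiv.Perm (Fin k))
    {μ : ProbabilityMeasure Ω2} (hμ : μ ∈ Mcal) (θ : ℝ) {S : ℝ}
    (hS : ∀ ν ∈ Mcal, KL (ν : Measure Ω2) μ ≠ ∞ →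
      θ * tPat σ (ν : Measure Ω2) - (KL (ν : Measure Ω2) μ).toReal ≤ S)
    {a : ℝ → Fin M} {b : ℝ → Fin N} (ha : Monotone a) (hb : Monotone b) (ha' : Measurable a)
    (hb' : Measurable b)
    (hma : ∀ v, (μ : Measure Ω2).real ((fun p => a p.1) ⁻¹' {v}) ≤ 1 / m)
    (hmb : ∀ v, (μ : Measure Ω2).real ((fun p => b p.2) ⁻¹' {v}) ≤ 1 / m)
    {z : Fin n → Ω2}
    (hz : ∀ i, (μ : Measure Ω2).real
      ((fun p : Ω2 => (a p.1, b p.2)) ⁻¹' {(a (z i).1, b (z i).2)}) ≠ 0) :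
    θ * vStat σ z ≤ S + |θ| * (4 * k ^ 2 * ((2 * |θ| + 1) / Real.log m)) +
      ∑ j, cellFreq (fun p : Ω2 => (a p.1, b p.2)) z j *
        Real.log (cellFreq (fun p : Ω2 => (a p.1, b p.2)) z j /
          (μ : Measure Ω2).real ((fun p : Ω2 => (a p.1, b p.2)) ⁻¹' {j})) := by
  classical
  set c : Ω2 → Fin M × Fin N := fun p => (a p.1, b p.2) with hcdef
  have hc : Measurable c := by fun_prop
  have hm' : (1 : ℝ) < m := by exact_mod_cast hm
  have hlog : 0 < Real.log m := Real.log_pos hm'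
  have hp0 : ∀ j, 0 ≤ cellFreq c z j := fun j => by unfold cellFreq; positivity
  have hp1 : ∑ j, cellFreq c z j = 1 := by
    have hn' : (n : ℝ) ≠ 0 := by exact_mod_cast hn.ne'
    have h := sum_cellFreq_mul hn c z fun _ => 1
    simp only [mul_one, Finset.sum_const, Finset.card_univ, Fintype.card_fin, nsmul_eq_mul] at h
    exact mul_left_cancel₀ hn' (h.trans (mul_one _).symm)
  obtain ⟨ν, hac, hKL, hKLeq, hcell⟩ := exists_lift_of_weights (μ := (μ : Measure Ω2)) hc hp0 hp1
    fun j hj => by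
      have : (Finset.univ.filter fun i => c (z i) = j) = ∅ :=
        Finset.filter_eq_empty_iff.2 fun i _ hij => hz i (by rw [← hij] at hj; exact hj)
      have h0 : ((Finset.univ.filter fun i => c (z i) = j).card : ℝ) / n = 0 := by simp [this]
      unfold cellFreq
      convert h0
  rw [← hKLeq]
  set D := (KL (ν : Measure Ω2) μ).toReal
  have hν : ν ∈ Mcal := mem_Mcal_of_absolutelyContinuous hμ hac
  have hSν := hS ν hν hKL
  have hV0 := vStat_nonneg σ z
  have hV1 := vStat_le_one hn σ z
  have hδ0 : 0 ≤ (2 * |θ| + 1) / Real.log m := by positivity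
  have herr0 : 0 ≤ |θ| * (4 * k ^ 2 * ((2 * |θ| + 1) / Real.log m)) := by positivity
  rcases le_or_gt (2 * |θ|) D with hlarge | hsmall
  · have hKLμ : KL (μ : Measure Ω2) μ = 0 := by
      rw [KL, if_pos Measure.AbsolutelyContinuous.rfl, lintegral_congr_ae (g := fun _ => 0)]
      · simp
      · filter_upwards [Measure.rnDeriv_self (μ : Measure Ω2)] with x hx
        simp [hx]
    have hSμ := hS μ hμ (by simp [hKLμ])
    rw [hKLμ] at hSμ
    have ht : |θ * tPat σ (μ : Measure Ω2)| ≤ |θ| := by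
      rw [abs_mul, abs_of_nonneg (tPat_nonneg _ _)]
      exact mul_le_of_le_one_right (abs_nonneg _) (tPat_le_one _ _)
    have hv : |θ * vStat σ z| ≤ |θ| := by
      rw [abs_mul, abs_of_nonneg hV0]
      exact mul_le_of_le_one_right (abs_nonneg _) hV1
    have := (abs_le.1 ht).1
    have := (abs_le.1 hv).2
    simp only [ENNReal.toReal_zero] at hSμ
    linarith
  · have hstrip : ∀ s : Set Ω2, MeasurableSet s → (μ : Measure Ω2).real s ≤ 1 / m →
        (ν : Measure Ω2).real s ≤ (2 * |θ| + 1) / Real.log m := by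
      intro s hs hsm
      have h := mul_measureReal_le_KL_add hKL hs (Real.log m)
      rw [Real.exp_log (by linarith)] at h
      have h2 : (m : ℝ) * (μ : Measure Ω2).real s ≤ 1 := by
        rw [le_div_iff₀ (by linarith)] at hsm
        linarith
      rw [le_div_iff₀ hlog]
      linarith
    have := isProbabilityMeasure_empMeas hn z
    have hmapeq : (empMeas z).map c = (ν : Measure Ω2).map c := by
      refine Measure.ext_of_singleton fun j => ?_
      have hj := measurableSet_singleton j
      have h1 := (empMeas_real_cell hc z j).trans (hcell j).symm
      rw [Measure.map_apply hc hj, Measure.map_apply hc hj]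
      exact (measureReal_eq_measureReal_iff).1 h1
    have hclose := abs_tPat_sub_tPat_le σ ha hb ha' hb' (ν : Measure Ω2) (empMeas z)
      (fun v => hstrip _ ((ha'.comp measurable_fst) (measurableSet_singleton v)) (hma v))
      (fun v => hstrip _ ((hb'.comp measurable_snd) (measurableSet_singleton v)) (hmb v))
      hδ0 hmapeq
    rw [tPat_empMeas hn] at hclose
    have h3 : θ * (vStat σ z - tPat σ (ν : Measure Ω2)) ≤
        |θ| * (4 * k ^ 2 * ((2 * |θ| + 1) / Real.log m)) := by
      refine (le_abs_self _).trans ?_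
      rw [abs_mul]
      exact mul_le_mul_of_nonneg_left hclose (abs_nonneg _)
    linarith

lemma log_integral_exp_vStat_le {k m : ℕ} (hm : 2 ≤ m) (σ : Equiv.Perm (Fin k))
    {μ : ProbabilityMeasure Ω2} (hμ : μ ∈ Mcal) (θ : ℝ) {S : ℝ}
    (hS : ∀ ν ∈ Mcal, KL (ν : Measure Ω2) μ ≠ ∞ →
      θ * tPat σ (ν : Measure Ω2) - (KL (ν : Measure Ω2) μ).toReal ≤ S) :
    ∃ K : ℕ, ∀ n : ℕ, 0 < n →
      Real.log (∫ z, Real.exp (n * θ * vStat σ z) ∂pmeas (μ : Measure Ω2) n) ≤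
        n * (S + |θ| * (4 * k ^ 2 * ((2 * |θ| + 1) / Real.log m))) + K * Real.log (n + 1) := by
  classical
  have hprob : ∀ {c : Ω2 → ℝ}, Measurable c →
      IsProbabilityMeasure ((μ : Measure Ω2).map c) := fun hc =>
    Measure.isProbabilityMeasure_map hc.aemeasurable
  have := hprob measurable_fst
  have := hprob measurable_snd
  obtain ⟨M, a, ha, ha', hma⟩ := exists_monotone_fine_partition ((μ : Measure Ω2).map Prod.fst)
    hμ.2.1 (show 0 < m by omega)
  obtain ⟨N, b, hb, hb', hmb⟩ := exists_monotone_fine_partition ((μ : Measure Ω2).map Prod.snd)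
    hμ.2.2 (show 0 < m by omega)
  have hma' : ∀ v, (μ : Measure Ω2).real ((fun p => a p.1) ⁻¹' {v}) ≤ 1 / m := fun v => by
    have := hma v
    rwa [map_measureReal_apply measurable_fst (ha' (measurableSet_singleton v))] at this
  have hmb' : ∀ v, (μ : Measure Ω2).real ((fun p => b p.2) ⁻¹' {v}) ≤ 1 / m := fun v => by
    have := hmb v
    rwa [map_measureReal_apply measurable_snd (hb' (measurableSet_singleton v))] at this
  set c : Ω2 → Fin M × Fin N := fun p => (a p.1, b p.2) with hcdef
  have hc : Measurable c := by fun_prop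
  set q : Fin M × Fin N → ℝ := fun j => (μ : Measure Ω2).real (c ⁻¹' {j}) with hq
  set E := |θ| * (4 * k ^ 2 * ((2 * |θ| + 1) / Real.log m))
  refine ⟨Fintype.card (Fin M × Fin N), fun n hn => ?_⟩
  have hn' : (0 : ℝ) < n := by exact_mod_cast hn
  set P := pmeas (μ : Measure Ω2) n with hP
  have : IsProbabilityMeasure P := by rw [hP, pmeas]; infer_instance
  set W : (Fin M × Fin N → Fin (n + 1)) → Fin M × Fin N → ℝ := fun w j => ((w j : ℕ) : ℝ) / n / q j
  have hW0 : ∀ w j, 0 ≤ W w j := fun w j => by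
    have : 0 ≤ q j := measureReal_nonneg
    positivity
  set valid := Finset.univ.filter fun w : Fin M × Fin N → Fin (n + 1) => ∑ j, (w j : ℕ) = n
  have hpt : ∀ᵐ z ∂P, Real.exp (n * θ * vStat σ z) ≤
      Real.exp (n * (S + E)) * ∑ w ∈ valid, ∏ i, W w (c (z i)) := by
    filter_upwards [ae_cell_ne_zero (n := n) (μ : Measure Ω2) (c := c)] with z hz
    have hkey := mul_vStat_le hn hm σ hμ θ hS ha hb ha' hb' hma' hmb' hz
    let w : Fin M × Fin N → Fin (n + 1) := fun j =>
      ⟨(Finset.univ.filter fun i => c (z i) = j).card,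
        Nat.lt_succ_of_le ((Finset.card_le_univ _).trans (Fintype.card_fin n).le)⟩
    have hwv : w ∈ valid := by
      refine Finset.mem_filter.2 ⟨Finset.mem_univ _, ?_⟩
      have := Finset.card_eq_sum_card_fiberwise (f := fun i => c (z i)) (s := Finset.univ)
        (t := Finset.univ) fun i _ => Finset.mem_univ _
      rw [Finset.card_univ, Fintype.card_fin] at this
      exact this.symm
    have hwf : ∀ j, ((w j : ℕ) : ℝ) / n = cellFreq c z j := fun j => by
      unfold cellFreq
      congr!
    have hWpos : ∀ i, 0 < W w (c (z i)) := fun i => by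
      have hqi : 0 < q (c (z i)) := lt_of_le_of_ne measureReal_nonneg (hz i).symm
      have hcard : 0 < (Finset.univ.filter fun i' => c (z i') = c (z i)).card :=
        Finset.card_pos.2 ⟨i, by simp⟩
      have : 0 < ((w (c (z i)) : ℕ) : ℝ) := Nat.cast_pos.2 hcard
      positivity
    have hlog : Real.log (∏ i, W w (c (z i))) =
        n * ∑ j, cellFreq c z j * Real.log (cellFreq c z j / q j) := by
      rw [Real.log_prod fun i _ => (hWpos i).ne', sum_cellFreq_mul hn]
      refine Finset.sum_congr rfl fun i _ => ?_
      simp only [W, hwf]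
    refine le_trans ?_ (mul_le_mul_of_nonneg_left (Finset.single_le_sum
      (fun w _ => Finset.prod_nonneg fun i _ => hW0 w _) hwv) (Real.exp_pos _).le)
    rw [← Real.exp_log (Finset.prod_pos fun i _ => hWpos i), ← Real.exp_add, Real.exp_le_exp, hlog,
      ← mul_add, mul_assoc]
    exact mul_le_mul_of_nonneg_left hkey hn'.le
  have hprodi : ∀ w, Integrable (fun z : Fin n → Ω2 => ∏ i, W w (c (z i))) P := fun w =>
    Integrable.fintype_prod (μ := fun _ => (μ : Measure Ω2)) (f := fun _ x => W w (c x)) fun _ =>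
      integrable_comp_finite (μ : Measure Ω2) hc (W w)
  have hprod1 : ∀ w ∈ valid, ∫ z, ∏ i, W w (c (z i)) ∂P ≤ 1 := by
    intro w hw
    have h1 : ∫ z, ∏ i, W w (c (z i)) ∂P =
        (∫ x, W w (c x) ∂(μ : Measure Ω2)) ^ Fintype.card (Fin n) :=
      integral_fintype_prod_eq_pow (ι := Fin n) (μ := (μ : Measure Ω2)) fun x => W w (c x)
    rw [h1]
    refine pow_le_one₀ (integral_nonneg fun x => hW0 _ _) ?_
    rw [integral_comp_finite (μ : Measure Ω2) hc]
    calc ∑ j, (μ : Measure Ω2).real (c ⁻¹' {j}) * W w j ≤ ∑ j, ((w j : ℕ) : ℝ) / n := by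
          refine Finset.sum_le_sum fun j _ => ?_
          change q j * (((w j : ℕ) : ℝ) / n / q j) ≤ _
          by_cases h : q j = 0
          · rw [h, zero_mul]; positivity
          · rw [mul_div_cancel₀ _ h]
      _ = 1 := by
          rw [← Finset.sum_div, ← Nat.cast_sum, (Finset.mem_filter.1 hw).2, div_self hn'.ne']
  have hub : ∫ z, Real.exp (n * θ * vStat σ z) ∂P ≤
      Real.exp (n * (S + E)) * ((n : ℝ) + 1) ^ Fintype.card (Fin M × Fin N) := by
    refine (integral_mono_of_nonneg (Eventually.of_forall fun z => (Real.exp_pos _).le)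
      ((integrable_finsetSum _ fun w _ => hprodi w).const_mul _) hpt).trans ?_
    rw [integral_const_mul, integral_finsetSum _ fun w _ => hprodi w]
    refine mul_le_mul_of_nonneg_left ?_ (Real.exp_pos _).le
    refine (Finset.sum_le_card_nsmul _ _ 1 hprod1).trans ?_
    rw [nsmul_eq_mul, mul_one]
    have : valid.card ≤ (n + 1) ^ Fintype.card (Fin M × Fin N) := by
      refine (Finset.card_le_univ _).trans ?_
      rw [Fintype.card_fun, Fintype.card_fin]
    exact_mod_cast this
  have hpos : 0 < ∫ z, Real.exp (n * θ * vStat σ z) ∂P := by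
    refine integral_exp_pos (Integrable.of_bound (Real.measurable_exp.comp
      (measurable_const.mul (measurable_vStat σ))).aestronglyMeasurable (Real.exp |n * θ|)
      (Eventually.of_forall fun z => ?_))
    rw [Real.norm_eq_abs, Real.abs_exp, Real.exp_le_exp]
    refine (le_abs_self _).trans ?_
    rw [abs_mul, abs_of_nonneg (vStat_nonneg σ z)]
    exact mul_le_of_le_one_right (abs_nonneg _) (vStat_le_one hn σ z)
  refine (Real.log_le_log hpos hub).trans (le_of_eq ?_)
  rw [Real.log_mul (Real.exp_pos _).ne' (by positivity), Real.log_exp, Real.log_pow]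

lemma tendsto_descFactorial_div_pow (k : ℕ) :
    Tendsto (fun n : ℕ => (n.descFactorial k : ℝ) / (n : ℝ) ^ k) atTop (𝓝 1) := by
  induction k with
  | zero => simp
  | succ k ih =>
    have h1 : Tendsto (fun n : ℕ => ((n - k : ℕ) : ℝ) / n) atTop (𝓝 1) := by
      have h : Tendsto (fun n : ℕ => 1 - (k : ℝ) / n) atTop (𝓝 (1 - 0)) :=
        tendsto_const_nhds.sub (tendsto_const_div_atTop_nhds_zero_nat (k : ℝ))
      rw [sub_zero] at h
      refine h.congr' ?_
      filter_upwards [eventually_ge_atTop k, eventually_gt_atTop 0] with n hk hn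
      have : (n : ℝ) ≠ 0 := by exact_mod_cast hn.ne'
      rw [Nat.cast_sub hk]
      field_simp
    have := h1.mul ih
    rw [one_mul] at this
    refine this.congr fun n => ?_
    rw [Nat.descFactorial_succ, Nat.cast_mul, pow_succ', mul_div_mul_comm]

/-- Theorem 1.9 (i): `F_n(σ,μ,θ)/n → F(σ,μ,θ) = sup_{ν∈ℳ}{θt_σ(ν) − D(ν|μ)}`. -/
theorem log_partition_limit {k : ℕ} (σ : Equiv.Perm (Fin k)) (μ : ProbabilityMeasure Ω2)
    (hμ : μ ∈ Mcal) (θ : ℝ) :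
    Tendsto (fun n : ℕ => ((Fn σ (↑μ) θ n / n : ℝ) : EReal)) atTop (𝓝 (Fsup σ (↑μ) θ)) := by
  have hterm : ∀ ν : ProbabilityMeasure Ω2, KL (ν : Measure Ω2) μ ≠ ∞ →
      (((θ * tPat σ (ν : Measure Ω2) : ℝ) : EReal) - ((KL (ν : Measure Ω2) μ : ℝ≥0∞) : EReal)) =
        ((θ * tPat σ (ν : Measure Ω2) - (KL (ν : Measure Ω2) μ).toReal : ℝ) : EReal) := by
    intro ν hν
    rw [EReal.coe_sub, EReal.coe_ennreal_toReal hν]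
  refine tendsto_order.2 ⟨fun x hx => ?_, fun x hx => ?_⟩
  · obtain ⟨ν, hν⟩ := lt_iSup_iff.1 hx
    obtain ⟨hνM, hlt⟩ := lt_iSup_iff.1 hν
    have hKL : KL (ν : Measure Ω2) μ ≠ ∞ := by
      intro h
      rw [h] at hlt
      simp at hlt
    rw [hterm ν hKL] at hlt
    have hlim : Tendsto (fun n : ℕ => θ * ((n.descFactorial k : ℝ) / (n : ℝ) ^ k *
        tPat σ (ν : Measure Ω2)) - (KL (ν : Measure Ω2) μ).toReal) atTop
        (𝓝 (θ * (1 * tPat σ (ν : Measure Ω2)) - (KL (ν : Measure Ω2) μ).toReal)) :=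
      (((tendsto_descFactorial_div_pow k).mul_const _).const_mul θ).sub_const _
    rw [one_mul] at hlim
    have hlimE := (continuous_coe_real_ereal.tendsto _).comp hlim
    filter_upwards [hlimE.eventually (lt_mem_nhds hlt), eventually_gt_atTop 0] with n hxn hn
    refine lt_of_lt_of_le hxn (EReal.coe_le_coe_iff.2 ?_)
    have hn' : (0 : ℝ) < n := by exact_mod_cast hn
    rw [Fn_eq_log_integral_vStat hn σ hμ, le_div_iff₀ hn', mul_comm]
    exact le_log_integral_exp_vStat hn σ hKL θ
  · obtain ⟨S, hS1, hS2⟩ := EReal.lt_iff_exists_real_btwn.1 hx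
    have hS : ∀ ν ∈ Mcal, KL (ν : Measure Ω2) μ ≠ ∞ →
        θ * tPat σ (ν : Measure Ω2) - (KL (ν : Measure Ω2) μ).toReal ≤ S := by
      intro ν hν hKL
      rw [← EReal.coe_le_coe_iff, ← hterm ν hKL]
      exact (le_iSup₂ (f := fun (ν : ProbabilityMeasure Ω2) (_ : ν ∈ Mcal) =>
        (((θ * tPat σ (ν : Measure Ω2) : ℝ) : EReal) -
          ((KL (ν : Measure Ω2) μ : ℝ≥0∞) : EReal))) ν hν).trans hS1.le
    obtain ⟨T, hT1, hT2⟩ := EReal.lt_iff_exists_real_btwn.1 hS2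
    have hST : S < T := EReal.coe_lt_coe_iff.1 hT1
    have herr : Tendsto (fun m : ℕ => S + |θ| * (4 * k ^ 2 * ((2 * |θ| + 1) / Real.log m))) atTop
        (𝓝 (S + |θ| * (4 * k ^ 2 * 0))) :=
      ((((Real.tendsto_log_atTop.comp tendsto_natCast_atTop_atTop).const_div_atTop _).const_mul
        _).const_mul _).const_add _
    rw [mul_zero, mul_zero, add_zero] at herr
    obtain ⟨m, hmT, hm⟩ := ((herr.eventually (gt_mem_nhds hST)).and (eventually_ge_atTop 2)).exists
    obtain ⟨K, hK⟩ := log_integral_exp_vStat_le hm σ hμ θ hS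
    have hlogn : Tendsto (fun n : ℕ => Real.log ((n : ℝ) + 1) / n) atTop (𝓝 0) := by
      have h1 : Tendsto (fun x : ℝ => Real.log (x + 1) / x) atTop (𝓝 0) := by
        have := Real.tendsto_pow_log_div_mul_add_atTop 1 (-1) 1 one_ne_zero
        refine (this.comp (tendsto_atTop_add_const_right atTop (1 : ℝ) tendsto_id)).congr
          fun x => ?_
        simp
      exact h1.comp tendsto_natCast_atTop_atTop
    have hlim : Tendsto (fun n : ℕ => S + |θ| * (4 * k ^ 2 * ((2 * |θ| + 1) / Real.log m)) +
        K * (Real.log ((n : ℝ) + 1) / n)) atTop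
        (𝓝 (S + |θ| * (4 * k ^ 2 * ((2 * |θ| + 1) / Real.log m)) + K * 0)) :=
      (hlogn.const_mul _).const_add _
    rw [mul_zero, add_zero] at hlim
    filter_upwards [hlim.eventually (gt_mem_nhds hmT), eventually_gt_atTop 0] with n hlt hn
    refine lt_trans (EReal.coe_lt_coe_iff.2 (lt_of_le_of_lt ?_ hlt)) hT2
    have hn' : (0 : ℝ) < n := by exact_mod_cast hn
    rw [Fn_eq_log_integral_vStat hn σ hμ, div_le_iff₀ hn']
    refine (hK n hn).trans (le_of_eq ?_)
    field_simp

end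
end
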